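/- arXiv:1703.09460 — 6 statements merged into one kernel-verified Lean document; each statement's English description precedes it below -/
import Mathlib

section
/- Let γ > 1 and 0 < a ≤ b. There exists a constant C > 0 such that for every r ∈ [a,b] and every ρ ≥ 0: if r/2 ≤ ρ ≤ 2r then H(ρ|r) ≥ C (ρ − r)², while if ρ < r/2 or ρ > 2r then H(ρ|r) ≥ C (1 + ρ)^γ. -/
noncomputable section

/-- Enthalpy `H(ρ) = ρ^γ/(γ-1)` for the pressure `p(ρ) = ρ^γ`. -/
def enthalpy (γ ρ : ℝ) : ℝ := ρ ^ γ / (γ - 1)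

/-- Modulated enthalpy `H(ρ|r) = H(ρ) - H(r) - H'(r)(ρ - r)`,
where `H'(r) = γ r^(γ-1)/(γ-1)`. -/
def enthalpyMod (γ ρ r : ℝ) : ℝ :=
  enthalpy γ ρ - enthalpy γ r - (γ * r ^ (γ - 1) / (γ - 1)) * (ρ - r)

/-- Bernoulli's inequality, recentred: the graph of `t ↦ t ^ γ` lies above its tangent at `1`. -/
lemma one_add_mul_sub_one_le_rpow {γ t : ℝ} (hγ : 1 ≤ γ) (ht : 0 ≤ t) :
    1 + γ * (t - 1) ≤ t ^ γ := by
  simpa using one_add_mul_self_le_rpow_one_add (s := t - 1) (by linarith) hγ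

/-- Strict Bernoulli inequality, recentred at `1`. -/
lemma one_add_mul_sub_one_lt_rpow {γ t : ℝ} (hγ : 1 < γ) (ht : 0 ≤ t) (ht1 : t ≠ 1) :
    1 + γ * (t - 1) < t ^ γ := by
  simpa using one_add_mul_self_lt_rpow_one_add (s := t - 1) (by linarith)
    (sub_ne_zero.mpr ht1) hγ

/-- On `[1/2, 2]` the gap in Bernoulli's inequality is at least quadratic. -/
lemma exists_mul_sq_le_rpow_sub_tangent {γ : ℝ} (hγ : 1 < γ) :
    ∃ c > 0, ∀ t ∈ Set.Icc (1 / 2 : ℝ) 2, c * (t - 1) ^ 2 ≤ t ^ γ - 1 - γ * (t - 1) := by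
  obtain ⟨m, hm, hmt⟩ : ∃ m > 0, ∀ t ∈ Set.Icc (1 / 2 : ℝ) 2, m ≤ t ^ (γ - 2) := by
    rcases le_total 2 γ with h | h
    · exact ⟨(1 / 2) ^ (γ - 2), by positivity, fun t ht =>
        Real.rpow_le_rpow (by norm_num) ht.1 (by linarith)⟩
    · exact ⟨2 ^ (γ - 2), by positivity, fun t ht =>
        Real.rpow_le_rpow_of_nonpos (by linarith [ht.1]) ht.2 (by linarith)⟩
  have hγm : 0 < γ * (γ - 1) * m := mul_pos (mul_pos (by linarith) (by linarith)) hm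
  refine ⟨γ * (γ - 1) * m / 2, by positivity, fun t ht => ?_⟩
  set c := γ * (γ - 1) * m / 2 with hc
  let h : ℝ → ℝ := fun t => t ^ γ - 1 - γ * (t - 1) - c * (t - 1) ^ 2
  have hd (x : ℝ) (hx : 0 < x) :
      HasDerivAt h (γ * x ^ (γ - 1) - γ - 2 * c * (x - 1)) x := by
    have h1 := (hasDerivAt_id x).sub_const 1
    have := (((Real.hasDerivAt_rpow_const (p := γ) (Or.inl hx.ne')).sub_const 1).sub
      (h1.const_mul γ)).sub ((h1.pow 2).const_mul c)
    refine this.congr_deriv ?_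
    simp
    ring
  have hd2 (x : ℝ) (hx : 0 < x) :
      HasDerivAt (fun x : ℝ => γ * x ^ (γ - 1) - γ - 2 * c * (x - 1))
        (γ * (γ - 1) * x ^ (γ - 2) - 2 * c) x := by
    have h1 := (hasDerivAt_id x).sub_const 1
    have := (((Real.hasDerivAt_rpow_const (p := γ - 1) (Or.inl hx.ne')).const_mul γ).sub_const
      γ).sub (h1.const_mul (2 * c))
    refine this.congr_deriv ?_
    rw [show γ - 1 - 1 = γ - 2 by ring]
    ring
  have hpos {x : ℝ} (hx : x ∈ Set.Icc (1 / 2 : ℝ) 2) : 0 < x := by linarith [hx.1]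
  have hconv : ConvexOn ℝ (Set.Icc (1 / 2 : ℝ) 2) h := by
    refine convexOn_of_hasDerivWithinAt2_nonneg (convex_Icc _ _)
      (fun x hx => (hd x (hpos hx)).continuousAt.continuousWithinAt)
      (fun x hx => (hd x (hpos (interior_subset hx))).hasDerivWithinAt)
      (fun x hx => (hd2 x (hpos (interior_subset hx))).hasDerivWithinAt) fun x hx => ?_
    have := mul_le_mul_of_nonneg_left (hmt x (interior_subset hx))
      (mul_nonneg (by linarith) (by linarith) : 0 ≤ γ * (γ - 1))
    linarith
  have hd1 : HasDerivAt h 0 1 := by simpa using hd 1 one_pos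
  have hone : (1 : ℝ) ∈ Set.Icc (1 / 2 : ℝ) 2 := by constructor <;> norm_num
  have h1 : h 1 = 0 := by simp [h]
  suffices 0 ≤ h t by simp only [h] at this; linarith
  rcases lt_trichotomy t 1 with hlt | rfl | hlt
  · have := hconv.slope_le_of_hasDerivAt ht hone hlt hd1
    rw [slope_def_field, div_le_iff₀ (by linarith)] at this
    linarith
  · exact h1.ge
  · have := hconv.le_slope_of_hasDerivAt hone ht hlt hd1
    rw [slope_def_field, le_div_iff₀ (by linarith)] at this
    linarith

/-- To the left of `1/2` the gap in Bernoulli's inequality is at least its value at `1/2`. -/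
lemma rpow_sub_tangent_half_le {γ t : ℝ} (hγ : 1 < γ) (ht : 0 ≤ t) (ht2 : t ≤ 1 / 2) :
    (1 / 2 : ℝ) ^ γ - 1 - γ * (1 / 2 - 1) ≤ t ^ γ - 1 - γ * (t - 1) := by
  have hB := one_add_mul_sub_one_le_rpow hγ.le (by linarith : 0 ≤ 2 * t)
  have hmul : t ^ γ = (1 / 2 : ℝ) ^ γ * (2 * t) ^ γ := by
    rw [← Real.mul_rpow (by norm_num) (by linarith)]; ring_nf
  have hhalf : (1 / 2 : ℝ) ^ γ ≤ 1 / 2 := by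
    simpa using Real.rpow_le_rpow_of_exponent_ge (x := 1 / 2) (by norm_num) (by norm_num) hγ.le
  have h1 := mul_le_mul_of_nonneg_left hB (by positivity : (0 : ℝ) ≤ (1 / 2) ^ γ)
  have h2 : 0 ≤ γ * (1 - 2 * t) * (1 / 2 - (1 / 2 : ℝ) ^ γ) :=
    mul_nonneg (mul_nonneg (by linarith) (by linarith)) (by linarith)
  rw [hmul]
  linarith

/-- To the right of `2` the gap in Bernoulli's inequality, relative to `t ^ γ`, is at least
its value at `2`. -/
lemma mul_rpow_le_rpow_sub_tangent {γ t : ℝ} (hγ : 1 < γ) (ht : 2 ≤ t) :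
    (1 - (1 + γ) / 2 ^ γ) * t ^ γ ≤ t ^ γ - 1 - γ * (t - 1) := by
  have hB := one_add_mul_sub_one_le_rpow hγ.le (by linarith : 0 ≤ t / 2)
  have hdiv : (1 + γ) / 2 ^ γ * t ^ γ = (1 + γ) * (t / 2) ^ γ := by
    rw [Real.div_rpow (by linarith) (by norm_num)]; ring
  have h1 := mul_le_mul_of_nonneg_left hB (by linarith : 0 ≤ 1 + γ)
  have h2 : 0 ≤ γ * (γ - 1) * (t - 2) :=
    mul_nonneg (mul_nonneg (by linarith) (by linarith)) (by linarith)
  rw [sub_mul, hdiv]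
  linarith

/-- Away from `[1/2, 2]` the gap in Bernoulli's inequality is of order `(1 + t) ^ γ`. -/
lemma exists_mul_one_add_rpow_le_rpow_sub_tangent {γ : ℝ} (hγ : 1 < γ) :
    ∃ c > 0, ∀ t : ℝ, 0 ≤ t → (t < 1 / 2 ∨ 2 < t) →
      c * (1 + t) ^ γ ≤ t ^ γ - 1 - γ * (t - 1) := by
  set d := (1 / 2 : ℝ) ^ γ - 1 - γ * (1 / 2 - 1) with hd
  set e := 1 - (1 + γ) / (2 : ℝ) ^ γ with he
  have h2γ : (0 : ℝ) < 2 ^ γ := by positivity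
  have hd0 : 0 < d := by
    have := one_add_mul_sub_one_lt_rpow hγ (t := 1 / 2) (by norm_num) (by norm_num)
    linarith
  have he0 : 0 < e := by
    have := one_add_mul_sub_one_lt_rpow hγ (t := 2) (by norm_num) (by norm_num)
    rw [he, sub_pos, div_lt_one h2γ]
    linarith
  refine ⟨min d e / 2 ^ γ, by positivity, fun t ht hfar => ?_⟩
  rw [div_mul_eq_mul_div, div_le_iff₀ h2γ]
  rcases hfar with hlt | hlt
  · have hp : (1 + t) ^ γ ≤ 2 ^ γ := Real.rpow_le_rpow (by linarith) (by linarith) (by linarith)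
    calc min d e * (1 + t) ^ γ ≤ d * 2 ^ γ := by gcongr; exact min_le_left _ _
      _ ≤ _ := by gcongr; exact rpow_sub_tangent_half_le hγ ht hlt.le
  · have hp : (1 + t) ^ γ ≤ t ^ γ * 2 ^ γ := by
      rw [← Real.mul_rpow ht (by norm_num)]
      exact Real.rpow_le_rpow (by linarith) (by linarith) (by linarith)
    calc min d e * (1 + t) ^ γ ≤ e * (t ^ γ * 2 ^ γ) := by gcongr; exact min_le_right _ _
      _ = e * t ^ γ * 2 ^ γ := by ring
      _ ≤ _ := by gcongr; exact mul_rpow_le_rpow_sub_tangent hγ hlt.le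

/-- Homogeneity of the modulated enthalpy. -/
lemma enthalpyMod_mul_self {γ t r : ℝ} (ht : 0 ≤ t) (hr : 0 < r) :
    enthalpyMod γ (t * r) r = r ^ γ / (γ - 1) * (t ^ γ - 1 - γ * (t - 1)) := by
  have h : r ^ γ = r ^ (γ - 1) * r := by
    rw [Real.rpow_sub_one hr.ne', div_mul_cancel₀ _ hr.ne']
  rw [enthalpyMod, enthalpy, enthalpy, Real.mul_rpow ht hr.le, h]
  ring

/-- Lower bounds on the modulated enthalpy: quadratic near `r`,
of order `(1+ρ)^γ` far from `r`, uniformly for `r` in a compact set `[a,b] ⊆ (0,∞)`. -/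
theorem enthalpyMod_lower_bounds (γ a b : ℝ) (hγ : 1 < γ) (ha : 0 < a) (hab : a ≤ b) :
    ∃ C > 0, ∀ r ∈ Set.Icc a b, ∀ ρ : ℝ, 0 ≤ ρ →
      ((r / 2 ≤ ρ ∧ ρ ≤ 2 * r) → enthalpyMod γ ρ r ≥ C * (ρ - r) ^ 2) ∧
      ((ρ < r / 2 ∨ 2 * r < ρ) → enthalpyMod γ ρ r ≥ C * (1 + ρ) ^ γ) := by
  obtain ⟨c₁, hc₁, hnear⟩ := exists_mul_sq_le_rpow_sub_tangent hγ
  obtain ⟨c₂, hc₂, hfar⟩ := exists_mul_one_add_rpow_le_rpow_sub_tangent hγ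
  have hγ1 : 0 < γ - 1 := by linarith
  have hb : 0 < b := ha.trans_le hab
  have hK : 0 < a ^ γ / (γ - 1) := by positivity
  refine ⟨a ^ γ / (γ - 1) * min (c₁ / b ^ 2) (c₂ / (1 + b) ^ γ), by positivity,
    fun r hr ρ hρ => ?_⟩
  have hr0 : 0 < r := ha.trans_le hr.1
  have hrb : r ≤ b := hr.2
  have hKr : a ^ γ / (γ - 1) ≤ r ^ γ / (γ - 1) := by
    gcongr
    exact hr.1
  obtain ⟨t, ht, rfl⟩ : ∃ t, 0 ≤ t ∧ ρ = t * r :=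
    ⟨ρ / r, by positivity, (div_mul_cancel₀ _ hr0.ne').symm⟩
  rw [enthalpyMod_mul_self ht hr0, ge_iff_le, ge_iff_le, mul_assoc, mul_assoc]
  refine ⟨fun ⟨h1, h2⟩ => ?_, fun h => ?_⟩
  · refine mul_le_mul hKr ?_ (by positivity) (by positivity)
    calc min (c₁ / b ^ 2) (c₂ / (1 + b) ^ γ) * (t * r - r) ^ 2
        ≤ c₁ / b ^ 2 * (b ^ 2 * (t - 1) ^ 2) := by
          rw [show (t * r - r) ^ 2 = r ^ 2 * (t - 1) ^ 2 by ring]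
          gcongr
          exact min_le_left _ _
      _ = c₁ * (t - 1) ^ 2 := by field_simp
      _ ≤ _ := hnear t ⟨by nlinarith, by nlinarith⟩
  · refine mul_le_mul hKr ?_ (by positivity) (by positivity)
    have hp : (1 + t * r) ^ γ ≤ (1 + b) ^ γ * (1 + t) ^ γ := by
      rw [← Real.mul_rpow (by linarith) (by linarith)]
      exact Real.rpow_le_rpow (by positivity) (by nlinarith) (by linarith)
    calc min (c₁ / b ^ 2) (c₂ / (1 + b) ^ γ) * (1 + t * r) ^ γ
        ≤ c₂ / (1 + b) ^ γ * ((1 + b) ^ γ * (1 + t) ^ γ) := by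
          gcongr
          exact min_le_right _ _
      _ = c₂ * (1 + t) ^ γ := by field_simp
      _ ≤ _ := hfar t ht (h.imp (fun h => by nlinarith) fun h => by nlinarith)
end
end

section
/- Let s ≥ −1 and γ ≥ s + 2 with γ > 1, and let 0 < a ≤ b. There exists a constant C > 0 such that for every r ∈ [a,b] and every ρ > 0: if r/2 ≤ ρ ≤ 2r then |φ₁(ρ|r)| ≤ C |ρ − r|², while if ρ < r/2 or ρ > 2r then |φ₁(ρ|r)| ≤ C (1 + ρ)^γ. Explicitly, φ₁(ρ|r) = ρ^γ − r^γ − (2γ/(s+3)) r^{γ−(s+3)/2} (ρ^{(s+3)/2} − r^{(s+3)/2}). -/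
noncomputable section

/-- `φ₁(ρ|r) = φ(μ(ρ)) − φ(μ(r)) − φ'(μ(r))(μ(ρ) − μ(r))` with `μ(ρ) = ρ^((s+3)/2)` and
`φ(τ) = τ^(2γ/(s+3))`, written out explicitly:
`φ₁(ρ|r) = ρ^γ − r^γ − (2γ/(s+3)) r^(γ−(s+3)/2) (ρ^((s+3)/2) − r^((s+3)/2))`. -/
def phi1 (γ s ρ r : ℝ) : ℝ :=
  ρ ^ γ - r ^ γ
    - (2 * γ / (s + 3)) * r ^ (γ - (s + 3) / 2) * (ρ ^ ((s + 3) / 2) - r ^ ((s + 3) / 2))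

/-- Real powers are Lipschitz on compact intervals of positive numbers. -/
theorem exists_abs_rpow_sub_rpow_le (β : ℝ) {l u : ℝ} (hl : 0 < l) :
    ∃ L, ∀ x ∈ Set.Icc l u, ∀ y ∈ Set.Icc l u, |x ^ β - y ^ β| ≤ L * |x - y| := by
  have hc : ContinuousOn (fun x : ℝ => β * x ^ (β - 1)) (Set.Icc l u) := fun x hx =>
    (continuousAt_const.mul
      (Real.continuousAt_rpow_const x _ (Or.inl (hl.trans_le hx.1).ne'))).continuousWithinAt
  obtain ⟨L, hL⟩ := isCompact_Icc.exists_bound_of_continuousOn hc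
  refine ⟨L, fun x hx y hy => ?_⟩
  exact (convex_Icc l u).norm_image_sub_le_of_norm_hasDerivWithin_le
    (f := fun z : ℝ => z ^ β) (f' := fun z => β * z ^ (β - 1))
    (fun z hz => (Real.hasDerivAt_rpow_const
      (Or.inl (hl.trans_le hz.1).ne')).hasDerivWithinAt) hL hy hx

/-- Quadratic bound on the first-order Taylor remainder of a real power, uniform on compact
intervals of positive numbers. -/
theorem exists_abs_rpow_taylor_le (α : ℝ) {l u : ℝ} (hl : 0 < l) :
    ∃ K, 0 ≤ K ∧ ∀ x ∈ Set.Icc l u, ∀ r ∈ Set.Icc l u,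
      |x ^ α - r ^ α - α * r ^ (α - 1) * (x - r)| ≤ K * |x - r| ^ 2 := by
  obtain ⟨L, hL⟩ := exists_abs_rpow_sub_rpow_le (α - 1) (u := u) hl
  refine ⟨|α| * |L|, by positivity, fun x hx r hr => ?_⟩
  have hsub : Set.uIcc r x ⊆ Set.Icc l u := Set.uIcc_subset_Icc hr hx
  have key := (convex_uIcc r x).norm_image_sub_le_of_norm_hasDerivWithin_le
    (f := fun z : ℝ => z ^ α - α * r ^ (α - 1) * z)
    (f' := fun z => α * z ^ (α - 1) - α * r ^ (α - 1) * 1) (C := |α| * |L| * |x - r|)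
    (fun z hz => ((Real.hasDerivAt_rpow_const
      (Or.inl (hl.trans_le (hsub hz).1).ne')).sub
        ((hasDerivAt_id z).const_mul _)).hasDerivWithinAt)
    (fun z hz => by
      rw [mul_one, ← mul_sub, Real.norm_eq_abs, abs_mul, mul_assoc]
      have hzr : |z - r| ≤ |x - r| := Set.abs_sub_left_of_mem_uIcc hz
      gcongr
      calc |z ^ (α - 1) - r ^ (α - 1)| ≤ L * |z - r| := hL z (hsub hz) r hr
        _ ≤ |L| * |x - r| := by gcongr; exact le_abs_self L)
    Set.left_mem_uIcc Set.right_mem_uIcc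
  simp only [Real.norm_eq_abs] at key
  calc |x ^ α - r ^ α - α * r ^ (α - 1) * (x - r)|
      = |x ^ α - α * r ^ (α - 1) * x - (r ^ α - α * r ^ (α - 1) * r)| := by congr 1; ring
    _ ≤ |α| * |L| * |x - r| * |x - r| := key
    _ = |α| * |L| * |x - r| ^ 2 := by ring

/-- Bounds on `φ₁(ρ|r)`: quadratic near `r`, of order `(1+ρ)^γ` far from `r`,
uniformly for `r` in a compact set `[a,b] ⊆ (0,∞)`. -/
theorem phi1_bounds (γ s a b : ℝ) (hs : -1 ≤ s) (hγs : s + 2 ≤ γ) (hγ : 1 < γ)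
    (ha : 0 < a) (hab : a ≤ b) :
    ∃ C > 0, ∀ r ∈ Set.Icc a b, ∀ ρ : ℝ, 0 < ρ →
      ((r / 2 ≤ ρ ∧ ρ ≤ 2 * r) → |phi1 γ s ρ r| ≤ C * |ρ - r| ^ 2) ∧
      ((ρ < r / 2 ∨ 2 * r < ρ) → |phi1 γ s ρ r| ≤ C * (1 + ρ) ^ γ) := by
  obtain ⟨m, hm⟩ : ∃ m, m = (s + 3) / 2 := ⟨_, rfl⟩
  obtain ⟨c, hc⟩ : ∃ c, c = 2 * γ / (s + 3) := ⟨_, rfl⟩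
  have hm1 : 1 ≤ m := by linarith
  have hmγ : m ≤ γ := by linarith
  have hc0 : 0 ≤ c := by rw [hc]; exact div_nonneg (by linarith) (by linarith)
  have hcm : c * m = γ := by
    rw [hc, hm]
    have : s + 3 ≠ 0 := by linarith
    field_simp
  have hb : 0 < b := ha.trans_le hab
  obtain ⟨K₁, hK₁, h₁⟩ := exists_abs_rpow_taylor_le γ (u := 2 * b) (half_pos ha)
  obtain ⟨K₂, hK₂, h₂⟩ := exists_abs_rpow_taylor_le m (u := 2 * b) (half_pos ha)
  have hA : 0 ≤ K₁ + c * b ^ (γ - m) * K₂ := by positivity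
  have hB : 0 < 1 + b ^ γ + c * b ^ (γ - m) * (1 + b ^ m) := by positivity
  refine ⟨(K₁ + c * b ^ (γ - m) * K₂) + (1 + b ^ γ + c * b ^ (γ - m) * (1 + b ^ m)),
    by positivity, fun r hr ρ hρ => ?_⟩
  have hr0 : 0 < r := ha.trans_le hr.1
  have hrb : r ^ (γ - m) ≤ b ^ (γ - m) := Real.rpow_le_rpow hr0.le hr.2 (by linarith)
  simp only [phi1, ← hm, ← hc]
  constructor
  · rintro ⟨hl, hu⟩
    have hρI : ρ ∈ Set.Icc (a / 2) (2 * b) := ⟨by linarith [hr.1], by linarith [hr.2]⟩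
    have hrI : r ∈ Set.Icc (a / 2) (2 * b) := ⟨by linarith [hr.1], by linarith [hr.2]⟩
    have hpow : r ^ (γ - 1) = r ^ (γ - m) * r ^ (m - 1) := by
      rw [← Real.rpow_add hr0]; congr 1; ring
    have hdecomp : ρ ^ γ - r ^ γ - c * r ^ (γ - m) * (ρ ^ m - r ^ m)
        = (ρ ^ γ - r ^ γ - γ * r ^ (γ - 1) * (ρ - r))
          - c * r ^ (γ - m) * (ρ ^ m - r ^ m - m * r ^ (m - 1) * (ρ - r)) := by
      rw [hpow]
      linear_combination (-(r ^ (γ - m) * r ^ (m - 1) * (ρ - r))) * hcm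
    rw [hdecomp]
    calc _ ≤ |ρ ^ γ - r ^ γ - γ * r ^ (γ - 1) * (ρ - r)|
          + |c * r ^ (γ - m) * (ρ ^ m - r ^ m - m * r ^ (m - 1) * (ρ - r))| := abs_sub _ _
      _ = |ρ ^ γ - r ^ γ - γ * r ^ (γ - 1) * (ρ - r)|
          + c * r ^ (γ - m) * |ρ ^ m - r ^ m - m * r ^ (m - 1) * (ρ - r)| := by
        rw [abs_mul (c * r ^ (γ - m)), abs_of_nonneg (a := c * r ^ (γ - m)) (by positivity)]
      _ ≤ K₁ * |ρ - r| ^ 2 + c * b ^ (γ - m) * (K₂ * |ρ - r| ^ 2) := by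
        gcongr
        · exact h₁ ρ hρI r hrI
        · exact h₂ ρ hρI r hrI
      _ = (K₁ + c * b ^ (γ - m) * K₂) * |ρ - r| ^ 2 := by ring
      _ ≤ _ := mul_le_mul_of_nonneg_right (by linarith) (by positivity)
  · intro _
    have hone : 1 ≤ (1 + ρ) ^ γ := Real.one_le_rpow (by linarith) (by linarith)
    have hργ : ρ ^ γ ≤ (1 + ρ) ^ γ := Real.rpow_le_rpow hρ.le (by linarith) (by linarith)
    have hρm : ρ ^ m ≤ (1 + ρ) ^ γ :=
      (Real.rpow_le_rpow hρ.le (by linarith) (by linarith)).trans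
        (Real.rpow_le_rpow_of_exponent_le (by linarith) hmγ)
    have hrγ : r ^ γ ≤ b ^ γ * (1 + ρ) ^ γ :=
      (Real.rpow_le_rpow hr0.le hr.2 (by linarith)).trans
        (le_mul_of_one_le_right (by positivity) hone)
    have hrm : r ^ m ≤ b ^ m * (1 + ρ) ^ γ :=
      (Real.rpow_le_rpow hr0.le hr.2 (by linarith)).trans
        (le_mul_of_one_le_right (by positivity) hone)
    have habs : ∀ x y : ℝ, 0 ≤ x → 0 ≤ y → |x - y| ≤ x + y := fun x y hx hy =>
      abs_le.2 ⟨by linarith, by linarith⟩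
    calc _ ≤ |ρ ^ γ - r ^ γ| + |c * r ^ (γ - m) * (ρ ^ m - r ^ m)| := abs_sub _ _
      _ = |ρ ^ γ - r ^ γ| + c * r ^ (γ - m) * |ρ ^ m - r ^ m| := by
        rw [abs_mul (c * r ^ (γ - m)), abs_of_nonneg (a := c * r ^ (γ - m)) (by positivity)]
      _ ≤ (ρ ^ γ + r ^ γ) + c * r ^ (γ - m) * (ρ ^ m + r ^ m) := by
        gcongr <;> exact habs _ _ (by positivity) (by positivity)
      _ ≤ ((1 + ρ) ^ γ + b ^ γ * (1 + ρ) ^ γ)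
          + c * b ^ (γ - m) * ((1 + ρ) ^ γ + b ^ m * (1 + ρ) ^ γ) := by gcongr
      _ = (1 + b ^ γ + c * b ^ (γ - m) * (1 + b ^ m)) * (1 + ρ) ^ γ := by ring
      _ ≤ _ := mul_le_mul_of_nonneg_right (by linarith) (by positivity)
end
end

section
/- Let s ≥ −1 and γ ≥ s + 2 with γ > 1, and let 0 < a ≤ b. There exists a constant C > 0 such that for every r ∈ [a,b] and every ρ > 0: if r/2 ≤ ρ ≤ 2r then |φ₂(ρ|r)| ≤ C |ρ − r|², while if ρ < r/2 or ρ > 2r then |φ₂(ρ|r)| ≤ C (1 + ρ)^γ. -/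
noncomputable section

/-- `μ(ρ) = ρ^((s+3)/2)`. -/
def muF (s ρ : ℝ) : ℝ := ρ ^ ((s + 3) / 2)

/-- `φ'(τ)` for `φ(τ) = τ^(2γ/(s+3))`. -/
def phiD (γ s τ : ℝ) : ℝ := (2 * γ / (s + 3)) * τ ^ (2 * γ / (s + 3) - 1)

/-- `φ''(τ)` for `φ(τ) = τ^(2γ/(s+3))`. -/
def phiDD (γ s τ : ℝ) : ℝ :=
  (2 * γ / (s + 3)) * (2 * γ / (s + 3) - 1) * τ ^ (2 * γ / (s + 3) - 2)

/-- `φ₂(ρ|r) = φ''(μ(r))(μ(ρ) − μ(r)) r − ρ(φ'(μ(ρ)) − φ'(μ(r)))`. -/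
def phi2 (γ s ρ r : ℝ) : ℝ :=
  phiDD γ s (muF s r) * (muF s ρ - muF s r) * r
    - ρ * (phiD γ s (muF s ρ) - phiD γ s (muF s r))

/-- Second-order Taylor bound for `t ↦ t ^ e` at `1`, on `[1/2, 2]`. -/
lemma exists_abs_rpow_sub_taylor_le (e : ℝ) :
    ∃ K, 0 ≤ K ∧ ∀ t ∈ Set.Icc (1 / 2 : ℝ) 2,
      |t ^ e - 1 - e * (t - 1)| ≤ K * |t - 1| ^ 2 := by
  have hpos : ∀ t ∈ Set.Icc (1 / 2 : ℝ) 2, t ≠ 0 := fun t ht => by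
    have := ht.1
    intro h
    norm_num [h] at this
  have hcont : ContinuousOn (fun t : ℝ => e * ((e - 1) * t ^ (e - 1 - 1)))
      (Set.Icc (1 / 2 : ℝ) 2) :=
    continuousOn_const.mul (continuousOn_const.mul
      (continuousOn_id.rpow_const fun t ht => Or.inl (hpos t ht)))
  obtain ⟨K, hK⟩ := isCompact_Icc.exists_bound_of_continuousOn hcont
  have h1 : (1 : ℝ) ∈ Set.Icc (1 / 2 : ℝ) 2 := by norm_num
  have hK0 : 0 ≤ K := (norm_nonneg _).trans (hK 1 h1)
  have hD : ∀ t ∈ Set.Icc (1 / 2 : ℝ) 2, |e * t ^ (e - 1) - e| ≤ K * |t - 1| := by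
    intro t ht
    have h := (convex_Icc (1 / 2 : ℝ) 2).norm_image_sub_le_of_norm_hasDerivWithin_le
      (f := fun t : ℝ => e * t ^ (e - 1))
      (fun x hx => ((Real.hasDerivAt_rpow_const (p := e - 1)
        (Or.inl (hpos x hx))).const_mul e).hasDerivWithinAt) hK h1 ht
    simpa using h
  refine ⟨K, hK0, fun t ht => ?_⟩
  have hsub : Set.uIcc 1 t ⊆ Set.Icc (1 / 2 : ℝ) 2 :=
    Set.ordConnected_Icc.uIcc_subset h1 ht
  have h := (convex_uIcc 1 t).norm_image_sub_le_of_norm_hasDerivWithin_le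
    (f := fun t : ℝ => t ^ e - 1 - e * (t - 1)) (f' := fun t => e * t ^ (e - 1) - e)
    (C := K * |t - 1|)
    (fun x hx => by
      have h2 := ((Real.hasDerivAt_rpow_const (p := e)
        (Or.inl (hpos x (hsub hx)))).sub_const 1).sub
          (((hasDerivAt_id x).sub_const 1).const_mul e)
      rw [mul_one] at h2
      exact h2.hasDerivWithinAt)
    (fun x hx => (hD x (hsub hx)).trans
      (mul_le_mul_of_nonneg_left (Set.abs_sub_left_of_mem_uIcc hx) hK0))
    Set.left_mem_uIcc Set.right_mem_uIcc
  simpa [pow_two, mul_assoc] using h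

/-- `φ₂` is homogeneous: it is a power of `r` times a function of `u = ρ / r`. -/
lemma phi2_mul_eq (γ s r u : ℝ) (hs : -1 ≤ s) (hr : 0 < r) (hu : 0 < u) :
    phi2 γ s (u * r) r = r ^ (γ - (s + 3) / 2 + 1) *
      ((2 * γ / (s + 3)) * (2 * γ / (s + 3) - 1) * (u ^ ((s + 3) / 2) - 1)
        - (2 * γ / (s + 3)) * (u ^ (γ - (s + 3) / 2 + 1) - u)) := by
  have hm : s + 3 ≠ 0 := by linarith
  have e1 : (s + 3) / 2 * (2 * γ / (s + 3) - 2) = γ - 2 * ((s + 3) / 2) := by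
    field_simp
  have e2 : (s + 3) / 2 * (2 * γ / (s + 3) - 1) = γ - (s + 3) / 2 := by
    field_simp
  simp only [phi2, phiD, phiDD, muF]
  rw [← Real.rpow_mul hr.le, ← Real.rpow_mul hr.le, ← Real.rpow_mul (mul_pos hu hr).le, e1, e2,
    Real.mul_rpow hu.le hr.le, Real.mul_rpow hu.le hr.le, Real.rpow_add_one hr.ne',
    Real.rpow_add_one hu.ne']
  have e3 : r ^ (γ - (s + 3) / 2) = r ^ (γ - 2 * ((s + 3) / 2)) * r ^ ((s + 3) / 2) := by
    rw [← Real.rpow_add hr]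
    congr 1
    ring
  rw [e3]
  ring

/-- Bounds on `φ₂(ρ|r)`: quadratic near `r`, of order `(1+ρ)^γ` far from `r`,
uniformly for `r` in a compact set `[a,b] ⊆ (0,∞)`. -/
theorem phi2_bounds (γ s a b : ℝ) (hs : -1 ≤ s) (hγs : s + 2 ≤ γ) (hγ : 1 < γ)
    (ha : 0 < a) (hab : a ≤ b) :
    ∃ C > 0, ∀ r ∈ Set.Icc a b, ∀ ρ : ℝ, 0 < ρ →
      ((r / 2 ≤ ρ ∧ ρ ≤ 2 * r) → |phi2 γ s ρ r| ≤ C * |ρ - r| ^ 2) ∧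
      ((ρ < r / 2 ∨ 2 * r < ρ) → |phi2 γ s ρ r| ≤ C * (1 + ρ) ^ γ) := by
  set m := (s + 3) / 2 with hm
  set p := 2 * γ / (s + 3) with hp
  set q := γ - m + 1 with hq
  have hs3 : 0 < s + 3 := by linarith
  have hm1 : 1 ≤ m := by rw [hm]; linarith
  have hmγ : m ≤ γ := by rw [hm]; linarith
  have hpm : p * m = γ := by rw [hp, hm]; field_simp
  have hq0 : 0 ≤ q := by rw [hq]; linarith
  have hqγ : q ≤ γ := by rw [hq]; linarith
  have hb : 0 < b := ha.trans_le hab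
  obtain ⟨K₁, hK₁, h₁⟩ := exists_abs_rpow_sub_taylor_le m
  obtain ⟨K₂, hK₂, h₂⟩ := exists_abs_rpow_sub_taylor_le q
  set g : ℝ → ℝ := fun u => p * (p - 1) * (u ^ m - 1) - p * (u ^ q - u) with hg
  have hphi : ∀ r u, 0 < r → 0 < u → phi2 γ s (u * r) r = r ^ q * g u :=
    fun r u hr hu => phi2_mul_eq γ s r u hs hr hu
  set A := |p * (p - 1)| * K₁ + |p| * K₂ with hA
  set B := |p * (p - 1)| * 2 + |p| * 2 with hB
  have hA0 : 0 ≤ A := by positivity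
  have hB0 : 0 ≤ B := by positivity
  have hnear : ∀ u ∈ Set.Icc (1 / 2 : ℝ) 2, |g u| ≤ A * |u - 1| ^ 2 := by
    intro u hu
    have e : g u = p * (p - 1) * (u ^ m - 1 - m * (u - 1))
        - p * (u ^ q - 1 - q * (u - 1)) := by
      simp only [hg, hq]
      linear_combination (p - 1) * (u - 1) * hpm + (u - 1) * hpm
    rw [e]
    refine (abs_sub _ _).trans ?_
    rw [abs_mul (p * (p - 1)), abs_mul p (u ^ q - 1 - q * (u - 1)), hA, add_mul _ _ (|u - 1| ^ 2),
      mul_assoc _ K₁, mul_assoc _ K₂]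
    exact add_le_add (mul_le_mul_of_nonneg_left (h₁ u hu) (abs_nonneg _))
      (mul_le_mul_of_nonneg_left (h₂ u hu) (abs_nonneg _))
  have hfar : ∀ u, 0 < u → |g u| ≤ B * (1 + u) ^ γ := by
    intro u hu
    have hpow : ∀ e, 0 ≤ e → e ≤ γ → 0 ≤ u ^ e ∧ u ^ e ≤ (1 + u) ^ γ := fun e he heγ =>
      ⟨by positivity, (Real.rpow_le_rpow hu.le (by linarith) he).trans
        (Real.rpow_le_rpow_of_exponent_le (by linarith) heγ)⟩
    obtain ⟨-, i0'⟩ := hpow 0 le_rfl (by linarith)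
    obtain ⟨i1, i1'⟩ := hpow 1 zero_le_one hγ.le
    obtain ⟨im, im'⟩ := hpow m (by linarith) hmγ
    obtain ⟨iq, iq'⟩ := hpow q hq0 hqγ
    rw [Real.rpow_zero] at i0'
    rw [Real.rpow_one] at i1 i1'
    refine (abs_sub _ _).trans ?_
    rw [abs_mul (p * (p - 1)), abs_mul p (u ^ q - u), hB, add_mul _ _ ((1 + u) ^ γ),
      mul_assoc _ 2, mul_assoc _ 2]
    exact add_le_add
      (mul_le_mul_of_nonneg_left (abs_le.2 ⟨by linarith, by linarith⟩) (abs_nonneg _))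
      (mul_le_mul_of_nonneg_left (abs_le.2 ⟨by linarith, by linarith⟩) (abs_nonneg _))
  have hC₁ : 0 ≤ b ^ q * A / a ^ 2 := by positivity
  have hC₂ : 0 ≤ b ^ q * B * (1 + 1 / a) ^ γ := by positivity
  refine ⟨b ^ q * A / a ^ 2 + b ^ q * B * (1 + 1 / a) ^ γ + 1, by positivity, ?_⟩
  rintro r ⟨har, hrb⟩ ρ hρ
  have hr : 0 < r := ha.trans_le har
  have hu : 0 < ρ / r := by positivity
  have hrq : r ^ q ≤ b ^ q := Real.rpow_le_rpow hr.le hrb hq0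
  have hrep : |phi2 γ s ρ r| = r ^ q * |g (ρ / r)| := by
    rw [← abs_of_nonneg (Real.rpow_nonneg hr.le q), ← abs_mul, ← hphi r _ hr hu,
      div_mul_cancel₀ _ hr.ne']
  rw [hrep]
  constructor
  · rintro ⟨hl, hh⟩
    have hmem : ρ / r ∈ Set.Icc (1 / 2 : ℝ) 2 :=
      ⟨by rw [le_div_iff₀ hr]; linarith, by rwa [div_le_iff₀ hr]⟩
    have hdiff : |ρ / r - 1| ^ 2 ≤ |ρ - r| ^ 2 / a ^ 2 := by
      rw [div_sub_one hr.ne', abs_div, div_pow, abs_of_pos hr]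
      gcongr
    calc r ^ q * |g (ρ / r)| ≤ b ^ q * (A * (|ρ - r| ^ 2 / a ^ 2)) :=
          mul_le_mul hrq ((hnear _ hmem).trans (mul_le_mul_of_nonneg_left hdiff hA0))
            (abs_nonneg _) (by positivity)
      _ = b ^ q * A / a ^ 2 * |ρ - r| ^ 2 := by ring
      _ ≤ _ := mul_le_mul_of_nonneg_right (by linarith) (by positivity)
  · intro _
    have hbase : 1 + ρ / r ≤ (1 + 1 / a) * (1 + ρ) := by
      have h3 : ρ / r ≤ ρ / a := by gcongr
      have h4 : 0 ≤ 1 / a := by positivity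
      calc 1 + ρ / r ≤ 1 + ρ / a := by linarith
        _ ≤ 1 + ρ / a + (1 / a + ρ) := by linarith
        _ = _ := by ring
    have hbase' : (1 + ρ / r) ^ γ ≤ (1 + 1 / a) ^ γ * (1 + ρ) ^ γ := by
      rw [← Real.mul_rpow (by positivity) (by positivity)]
      exact Real.rpow_le_rpow (by positivity) hbase (by linarith)
    calc r ^ q * |g (ρ / r)| ≤ b ^ q * (B * ((1 + 1 / a) ^ γ * (1 + ρ) ^ γ)) :=
          mul_le_mul hrq ((hfar _ hu).trans (mul_le_mul_of_nonneg_left hbase' hB0))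
            (abs_nonneg _) (by positivity)
      _ = b ^ q * B * (1 + 1 / a) ^ γ * (1 + ρ) ^ γ := by ring
      _ ≤ _ := mul_le_mul_of_nonneg_right (by linarith) (by positivity)
end
end

section
/- Let s ≥ −1 and γ ≥ s + 2 with γ > 1, and let 0 < a ≤ b. There exists a constant C > 0 such that for every r ∈ [a,b] and every ρ > 0 one has ρ |μ'(ρ) − μ'(r)|² ≤ C H(ρ|r), where μ'(ρ) = ((s+3)/2) ρ^{(s+1)/2}. -/
noncomputable section

/-- `μ'(ρ) = ((s+3)/2) ρ^((s+1)/2)`, the derivative of `μ(ρ) = ρ^((s+3)/2)`. -/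
def muD (s ρ : ℝ) : ℝ := ((s + 3) / 2) * ρ ^ ((s + 1) / 2)

/-- Bernoulli's inequality bounds `t (t^β - 1)²` by the relative enthalpy with exponent `2β + 1`
at the reference density `1`. -/
lemma mul_sq_rpow_sub_one_le {t β : ℝ} (ht : 0 < t) (hβ : 0 ≤ β) :
    t * (t ^ β - 1) ^ 2 ≤ t ^ (2 * β + 1) - 1 - (2 * β + 1) * (t - 1) := by
  have bernoulli := one_add_mul_self_le_rpow_one_add (s := t - 1) (by linarith)
    (p := β + 1) (by linarith)
  rw [add_sub_cancel, Real.rpow_add_one ht.ne'] at bernoulli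
  have hpow : t ^ (2 * β + 1) = t ^ β * t ^ β * t := by
    rw [Real.rpow_add_one ht.ne', two_mul, Real.rpow_add ht]
  rw [hpow]
  linarith

lemma sq_rpow_sub_one_le_sq_rpow_sub_one {t α β : ℝ} (ht : 0 < t) (hα : 0 ≤ α) (hαβ : α ≤ β) :
    (t ^ α - 1) ^ 2 ≤ (t ^ β - 1) ^ 2 := by
  rcases le_total 1 t with h | h
  · have h1 := Real.one_le_rpow h hα
    have h2 := Real.rpow_le_rpow_of_exponent_le h hαβ
    nlinarith
  · have h1 := Real.rpow_le_one ht.le h hα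
    have h2 := Real.rpow_le_rpow_of_exponent_ge ht h hαβ
    nlinarith

lemma enthalpyMod_mul {γ r t : ℝ} (hr : 0 < r) (ht : 0 < t) :
    enthalpyMod γ (r * t) r = r ^ γ / (γ - 1) * (t ^ γ - 1 - γ * (t - 1)) := by
  have hpow : r ^ γ = r ^ (γ - 1) * r := by
    rw [← Real.rpow_add_one hr.ne', sub_add_cancel]
  unfold enthalpyMod enthalpy
  rw [Real.mul_rpow hr.le ht.le, hpow]
  ring

lemma mul_sq_muD_sub_mul {s r t : ℝ} (hr : 0 < r) (ht : 0 < t) :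
    r * t * |muD s (r * t) - muD s r| ^ 2 =
      ((s + 3) / 2) ^ 2 * r ^ (s + 2) * (t * (t ^ ((s + 1) / 2) - 1) ^ 2) := by
  have hpow : r ^ (s + 2) = r ^ ((s + 1) / 2) * r ^ ((s + 1) / 2) * r := by
    rw [← Real.rpow_add hr, ← Real.rpow_add_one hr.ne']
    ring_nf
  unfold muD
  rw [sq_abs, Real.mul_rpow hr.le ht.le, hpow]
  ring

/-- `ρ |μ'(ρ) − μ'(r)|²` is controlled by the modulated enthalpy `H(ρ|r)`,
uniformly for `r` in a compact set `[a,b] ⊆ (0,∞)`. -/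
theorem rho_mul_sq_muD_sub_le_enthalpyMod (γ s a b : ℝ) (hs : -1 ≤ s) (hγs : s + 2 ≤ γ)
    (hγ : 1 < γ) (ha : 0 < a) (hab : a ≤ b) :
    ∃ C > 0, ∀ r ∈ Set.Icc a b, ∀ ρ : ℝ, 0 < ρ →
      ρ * |muD s ρ - muD s r| ^ 2 ≤ C * enthalpyMod γ ρ r := by
  have hγ' : 0 < γ - 1 := by linarith
  have hs' : 0 < (s + 3) / 2 := by linarith
  refine ⟨((s + 3) / 2) ^ 2 * (γ - 1) * a ^ (s + 2 - γ), by positivity, ?_⟩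
  rintro r ⟨har, -⟩ ρ hρ
  have hr : 0 < r := ha.trans_le har
  obtain ⟨t, ht, rfl⟩ : ∃ t, 0 < t ∧ ρ = r * t :=
    ⟨ρ / r, by positivity, by field_simp⟩
  have hrpow : r ^ (s + 2) ≤ a ^ (s + 2 - γ) * r ^ γ := by
    calc r ^ (s + 2) = r ^ (s + 2 - γ) * r ^ γ := by
          rw [← Real.rpow_add hr, sub_add_cancel]
      _ ≤ a ^ (s + 2 - γ) * r ^ γ :=
          mul_le_mul_of_nonneg_right
            (Real.rpow_le_rpow_of_nonpos ha har (by linarith)) (by positivity)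
  have hprofile : t * (t ^ ((s + 1) / 2) - 1) ^ 2 ≤ t ^ γ - 1 - γ * (t - 1) := by
    calc t * (t ^ ((s + 1) / 2) - 1) ^ 2 ≤ t * (t ^ ((γ - 1) / 2) - 1) ^ 2 :=
          mul_le_mul_of_nonneg_left
            (sq_rpow_sub_one_le_sq_rpow_sub_one ht (by linarith) (by linarith)) ht.le
      _ ≤ t ^ γ - 1 - γ * (t - 1) := by
          have h := mul_sq_rpow_sub_one_le ht (β := (γ - 1) / 2) (by linarith)
          rwa [mul_div_cancel₀ _ two_ne_zero, sub_add_cancel] at h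
  rw [mul_sq_muD_sub_mul hr ht, enthalpyMod_mul hr ht]
  calc ((s + 3) / 2) ^ 2 * r ^ (s + 2) * (t * (t ^ ((s + 1) / 2) - 1) ^ 2)
      ≤ ((s + 3) / 2) ^ 2 * (a ^ (s + 2 - γ) * r ^ γ) * (t ^ γ - 1 - γ * (t - 1)) := by
        gcongr
    _ = ((s + 3) / 2) ^ 2 * (γ - 1) * a ^ (s + 2 - γ) *
          (r ^ γ / (γ - 1) * (t ^ γ - 1 - γ * (t - 1))) := by
        field_simp
end
end

section
/- Let Ω ⊆ ℝ^d be open, K : (0,∞) → (0,∞) smooth, and μ : (0,∞) → ℝ smooth with μ'(t) = √(t K(t)); set λ(t) = 2(t μ'(t) − μ(t)). Let ρ : Ω → (0,∞) be C³ and set v = ∇(μ∘ρ)/ρ. Then at every point of Ω and for every component i ∈ {1,…,d}: ρ ∂_i ( K(ρ) Δρ + (1/2) K'(ρ) |∇ρ|² ) = Σ_j ∂_j ( μ(ρ) ∂_j v_i ) + (1/2) ∂_i ( λ(ρ) div v ), i.e. ρ ∇(K(ρ)Δρ + ½K'(ρ)|∇ρ|²) = div(μ(ρ) ∇v) + ½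 ∇(λ(ρ) div v). -/
noncomputable section

abbrev Vec (d : ℕ) := Fin d → ℝ

/-- Spatial partial derivative in direction `i`. -/
noncomputable def pd {d : ℕ} (i : Fin d) (f : Vec d → ℝ) (x : Vec d) : ℝ :=
  fderiv ℝ f x (Pi.single i 1)

section PartialDerivatives

variable {d : ℕ} {f g : Vec d → ℝ} {x : Vec d}

lemma pd_congr (i : Fin d) (h : f =ᶠ[nhds x] g) : pd i f x = pd i g x := by
  simp only [pd, h.fderiv_eq]

lemma pd_add (i : Fin d) (hf : DifferentiableAt ℝ f x) (hg : DifferentiableAt ℝ g x) :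
    pd i (fun y => f y + g y) x = pd i f x + pd i g x := by
  simp [pd, fderiv_fun_add hf hg]

lemma pd_mul (i : Fin d) (hf : DifferentiableAt ℝ f x) (hg : DifferentiableAt ℝ g x) :
    pd i (fun y => f y * g y) x = pd i f x * g x + f x * pd i g x := by
  simp [pd, fderiv_fun_mul hf hg]
  ring

lemma pd_const_mul (i : Fin d) (c : ℝ) (hf : DifferentiableAt ℝ f x) :
    pd i (fun y => c * f y) x = c * pd i f x := by
  simp [pd, fderiv_const_mul hf c]

lemma pd_sum {ι : Type*} (s : Finset ι) {F : ι → Vec d → ℝ} (i : Fin d)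
    (hF : ∀ j ∈ s, DifferentiableAt ℝ (F j) x) :
    pd i (fun y => ∑ j ∈ s, F j y) x = ∑ j ∈ s, pd i (F j) x := by
  simp [pd, fderiv_fun_sum hF]

lemma pd_comp {φ : ℝ → ℝ} {φ' : ℝ} (i : Fin d) (hφ : HasDerivAt φ φ' (f x))
    (hf : DifferentiableAt ℝ f x) :
    pd i (fun y => φ (f y)) x = φ' * pd i f x := by
  have h := hφ.comp_hasFDerivAt x hf.hasFDerivAt
  have h' : fderiv ℝ (fun y => φ (f y)) x = φ' • fderiv ℝ f x := h.fderiv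
  simp [pd, h']

lemma ContDiffAt.pd {m n : WithTop ℕ∞} (i : Fin d) (hf : ContDiffAt ℝ n f x)
    (hmn : m + 1 ≤ n) : ContDiffAt ℝ m (pd i f) x :=
  (hf.fderiv_right hmn).clm_apply contDiffAt_const

lemma pd_comm (i j : Fin d) (hf : ContDiffAt ℝ 2 f x) :
    pd i (pd j f) x = pd j (pd i f) x := by
  have hd : DifferentiableAt ℝ (fderiv ℝ f) x :=
    (hf.fderiv_right (m := 1) (by norm_num)).differentiableAt (by norm_num)
  have key (a b : Fin d) : pd a (pd b f) x =
      fderiv ℝ (fderiv ℝ f) x (Pi.single a 1) (Pi.single b 1) := by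
    have h := (hd.hasFDerivAt.clm_apply (hasFDerivAt_const (Pi.single b (1 : ℝ)) x)).fderiv
    change fderiv ℝ (fun y => fderiv ℝ f y (Pi.single b 1)) x (Pi.single a 1) = _
    rw [h]
    simp
  rw [key, key]
  exact hf.isSymmSndFDerivAt (by simp) _ _

end PartialDerivatives

/-- Generalized Bohm identity: with `μ'(t) = √(t K(t))`, `λ(t) = 2(t μ'(t) − μ(t))` and the
drift velocity `v = ∇(μ∘ρ)/ρ`, one has, componentwise on an open set `Ω`,
`ρ ∇(K(ρ)Δρ + ½K'(ρ)|∇ρ|²) = div(μ(ρ)∇v) + ½∇(λ(ρ) div v)`. -/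
theorem generalized_bohm_identity (d : ℕ) (Ω : Set (Vec d)) (hΩ : IsOpen Ω)
    (K μ : ℝ → ℝ)
    (hK : ContDiffOn ℝ (⊤ : ℕ∞) K (Set.Ioi 0)) (hKpos : ∀ t : ℝ, 0 < t → 0 < K t)
    (hμ : ContDiffOn ℝ (⊤ : ℕ∞) μ (Set.Ioi 0))
    (hμ' : ∀ t : ℝ, 0 < t → HasDerivAt μ (Real.sqrt (t * K t)) t)
    (ρ : Vec d → ℝ) (hρ : ContDiffOn ℝ 3 ρ Ω) (hρpos : ∀ x ∈ Ω, 0 < ρ x)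
    (v : Vec d → Vec d)
    (hv : ∀ x ∈ Ω, ∀ i, v x i = pd i (fun y => μ (ρ y)) x / ρ x) :
    ∀ x ∈ Ω, ∀ i : Fin d,
      ρ x * pd i (fun y => K (ρ y) * (∑ j, pd j (fun z => pd j ρ z) y)
              + (1 / 2) * deriv K (ρ y) * ∑ j, (pd j ρ y) ^ 2) x
        = (∑ j, pd j (fun y => μ (ρ y) * pd j (fun z => v z i) y) x)
          + (1 / 2) * pd i (fun y =>
              (2 * (ρ y * Real.sqrt (ρ y * K (ρ y)) - μ (ρ y)))
                * ∑ j, pd j (fun z => v z j) y) x := by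
  intro x hx i
  set m : ℝ → ℝ := fun t => Real.sqrt (t * K t) with hm
  set g : ℝ → ℝ := fun t => m t / t with hg
  have hmC (t : ℝ) (ht : 0 < t) : ContDiffAt ℝ (⊤ : ℕ∞) m t :=
    (contDiffAt_id.mul (hK.contDiffAt (Ioi_mem_nhds ht))).sqrt (mul_pos ht (hKpos t ht)).ne'
  have hgC (t : ℝ) (ht : 0 < t) : ContDiffAt ℝ (⊤ : ℕ∞) g t :=
    (hmC t ht).div contDiffAt_id ht.ne'
  have hmg (t : ℝ) (ht : 0 < t) : m t = t * g t := by
    simp only [hg]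
    field_simp
  have hKg (t : ℝ) (ht : 0 < t) : K t = t * (g t * g t) := by
    have h : m t * m t = t * K t := Real.mul_self_sqrt (mul_pos ht (hKpos t ht)).le
    rw [hmg t ht] at h
    have := ht.ne'
    apply mul_left_cancel₀ this
    linarith
  have hK' (t : ℝ) (ht : 0 < t) : deriv K t = g t * g t + 2 * t * g t * deriv g t := by
    have hgd : HasDerivAt g (deriv g t) t :=
      ((hgC t ht).differentiableAt (by simp)).hasDerivAt
    have h := (hasDerivAt_id t).mul (hgd.mul hgd)
    have he : K =ᶠ[nhds t] (id * (g * g)) := by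
      filter_upwards [Ioi_mem_nhds ht] with s hs using hKg s hs
    rw [he.deriv_eq, h.deriv]
    simp
    ring
  have hρC (y : Vec d) (hy : y ∈ Ω) : ContDiffAt ℝ 3 ρ y := hρ.contDiffAt (hΩ.mem_nhds hy)
  have hρd (y : Vec d) (hy : y ∈ Ω) : DifferentiableAt ℝ ρ y :=
    (hρC y hy).differentiableAt (by norm_num)
  have hpρ (y : Vec d) (hy : y ∈ Ω) (j : Fin d) : ContDiffAt ℝ 2 (pd j ρ) y :=
    (hρC y hy).pd j (by norm_num)
  have hcomp {φ : ℝ → ℝ} (hφ : ∀ t, 0 < t → ContDiffAt ℝ (⊤ : ℕ∞) φ t) (y : Vec d)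
      (hy : y ∈ Ω) : ContDiffAt ℝ 3 (fun z => φ (ρ z)) y :=
    ContDiffAt.comp y ((hφ _ (hρpos y hy)).of_le (WithTop.coe_le_coe.2 (le_top : (3 : ℕ∞) ≤ ⊤))) (hρC y hy)
  have hveq (y : Vec d) (hy : y ∈ Ω) (j : Fin d) : v y j = g (ρ y) * pd j ρ y := by
    rw [hv y hy j, pd_comp j (hμ' _ (hρpos y hy)) (hρd y hy)]
    simp only [hg, hm]
    ring
  have hvev (y : Vec d) (hy : y ∈ Ω) (j : Fin d) :
      (fun z => v z j) =ᶠ[nhds y] fun z => g (ρ z) * pd j ρ z := by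
    filter_upwards [hΩ.mem_nhds hy] with z hz using hveq z hz j
  have hvC (y : Vec d) (hy : y ∈ Ω) (j : Fin d) : ContDiffAt ℝ 2 (fun z => v z j) y :=
    (((hcomp hgC y hy).of_le (by norm_num)).mul (hpρ y hy j)).congr_of_eventuallyEq (hvev y hy j)
  have hpv (y : Vec d) (hy : y ∈ Ω) (j k : Fin d) : pd j (fun z => v z k) y =
      deriv g (ρ y) * pd j ρ y * pd k ρ y + g (ρ y) * pd j (pd k ρ) y := by
    rw [pd_congr j (hvev y hy k), pd_mul j ((hcomp hgC y hy).differentiableAt (by norm_num))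
      ((hpρ y hy k).differentiableAt (by norm_num)),
      pd_comp j ((hgC _ (hρpos y hy)).differentiableAt (by simp)).hasDerivAt (hρd y hy)]
  have hcurl (y : Vec d) (hy : y ∈ Ω) (j k : Fin d) :
      pd j (fun z => v z k) y = pd k (fun z => v z j) y := by
    rw [hpv y hy, hpv y hy, pd_comm j k ((hρC y hy).of_le (by norm_num))]
    ring
  have hpvd (j k : Fin d) : DifferentiableAt ℝ (pd j (fun z => v z k)) x :=
    ((hvC x hx k).pd (m := 1) j (by norm_num)).differentiableAt (by norm_num)
  have hvd (j : Fin d) : DifferentiableAt ℝ (fun z => v z j) x :=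
    (hvC x hx j).differentiableAt (by norm_num)
  set D : Vec d → ℝ := fun y => ∑ j, pd j (fun z => v z j) y with hD
  have hDd : DifferentiableAt ℝ D x := DifferentiableAt.fun_sum fun j _ => hpvd j j
  have hmd : DifferentiableAt ℝ (fun y => m (ρ y)) x :=
    (hcomp hmC x hx).differentiableAt (by norm_num)
  have hμd : DifferentiableAt ℝ (fun y => μ (ρ y)) x :=
    ((hμ' _ (hρpos x hx)).differentiableAt).comp x (hρd x hx)
  have hpressure : (fun y => K (ρ y) * (∑ j, pd j (fun z => pd j ρ z) y)
      + (1 / 2) * deriv K (ρ y) * ∑ j, (pd j ρ y) ^ 2) =ᶠ[nhds x]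
      fun y => m (ρ y) * D y + (1 / 2) * ∑ j, v y j * v y j := by
    filter_upwards [hΩ.mem_nhds hx] with y hy
    have hr := hρpos y hy
    have hD' : D y = deriv g (ρ y) * ∑ j, (pd j ρ y) ^ 2
        + g (ρ y) * ∑ j, pd j (fun z => pd j ρ z) y := by
      simp only [hD, Finset.mul_sum, ← Finset.sum_add_distrib]
      refine Finset.sum_congr rfl fun j _ => ?_
      rw [hpv y hy]
      ring
    have hV : ∑ j, v y j * v y j = g (ρ y) * g (ρ y) * ∑ j, (pd j ρ y) ^ 2 := by
      rw [Finset.mul_sum]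
      refine Finset.sum_congr rfl fun j _ => ?_
      rw [hveq y hy]
      ring
    rw [hD', hV, hK' _ hr, hKg _ hr, hmg _ hr]
    ring
  have hpD : ∑ j, pd j (pd j (fun z => v z i)) x = pd i D x := by
    rw [hD, pd_sum _ _ fun j _ => hpvd j j]
    refine Finset.sum_congr rfl fun j _ => ?_
    rw [← pd_comm j i (hvC x hx j)]
    apply pd_congr
    filter_upwards [hΩ.mem_nhds hx] with y hy using hcurl y hy j i
  have hdiff : ∑ j, pd j (fun y => μ (ρ y) * pd j (fun z => v z i) y) x
      = ρ x * ∑ j, v x j * pd i (fun z => v z j) x + μ (ρ x) * pd i D x := by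
    rw [← hpD, Finset.mul_sum, Finset.mul_sum, ← Finset.sum_add_distrib]
    refine Finset.sum_congr rfl fun j _ => ?_
    rw [pd_mul j hμd (hpvd j i), pd_comp j (hμ' _ (hρpos x hx)) (hρd x hx), hveq x hx,
      hcurl x hx j i]
    change m (ρ x) * _ * _ + _ = _
    rw [hmg _ (hρpos x hx)]
    ring
  have hsq : pd i (fun y => ∑ j, v y j * v y j) x
      = 2 * ∑ j, v x j * pd i (fun z => v z j) x := by
    rw [pd_sum _ _ fun j _ => (hvd j).fun_mul (hvd j), Finset.mul_sum]
    refine Finset.sum_congr rfl fun j _ => ?_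
    rw [pd_mul i (hvd j) (hvd j)]
    ring
  have hsqd : DifferentiableAt ℝ (fun y => ∑ j, v y j * v y j) x :=
    DifferentiableAt.fun_sum fun j _ => (hvd j).fun_mul (hvd j)
  have hlam : HasDerivAt (fun t => 2 * (t * m t - μ t)) (2 * (ρ x * deriv m (ρ x))) (ρ x) := by
    have hmd' := ((hmC _ (hρpos x hx)).differentiableAt (by simp)).hasDerivAt
    refine ((((hasDerivAt_id' (ρ x)).fun_mul hmd').fun_sub (hμ' _ (hρpos x hx))).const_mul 2).congr_deriv ?_
    change 2 * (1 * m (ρ x) + ρ x * deriv m (ρ x) - m (ρ x)) = _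
    ring
  have hvisc : pd i (fun y => (2 * (ρ y * m (ρ y) - μ (ρ y))) * D y) x
      = 2 * (ρ x * deriv m (ρ x)) * pd i ρ x * D x
        + 2 * (ρ x * m (ρ x) - μ (ρ x)) * pd i D x := by
    rw [pd_mul i ((((hρd x hx).fun_mul hmd).fun_sub hμd).const_mul 2) hDd, pd_comp i hlam (hρd x hx)]
  change _ = _ + (1 / 2) * pd i (fun y => (2 * (ρ y * m (ρ y) - μ (ρ y))) * D y) x
  rw [pd_congr i hpressure, pd_add i (hmd.fun_mul hDd) (hsqd.const_mul _), pd_mul i hmd hDd,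
    pd_const_mul i _ hsqd, hsq, hdiff, hvisc,
    pd_comp i ((hmC _ (hρpos x hx)).differentiableAt (by simp)).hasDerivAt (hρd x hx)]
  ring
end
end

section
/- Let 1 ≤ d ≤ 3, T > 0, ε > 0, ν > 0, γ > 1, s ≥ −1, and let (ρ, u) be smooth on [0,T] × 𝕋^d with ρ > 0, satisfying pointwise the Navier–Stokes–Korteweg system ∂_t ρ + div(ρu) = 0 and ∂_t(ρu) + div(ρu⊗u) + ∇p(ρ) − 2ν div(μ(ρ)D(u)) − ν∇(λ(ρ) div u) = ε²[div(μ(ρ)ᵗ∇v) + ½∇(λ(ρ) div v)], where v = ∇(μ∘ρ)/ρ, D(u) = ½(∇u + ᵗ∇u), and set w = u + ν v. Then for all t ∈ [0,T]: (d/dt) ∫_{𝕋^d} ( ((ν²+ε²)/2) ρ|v|² + ½ρ|w|² + H(ρ) ) + ν ∫_{𝕋^d} ( μ(ρ)(|∇u|² + ε²|∇v|²) + μ'(ρ)H''(ρ)|∇ρ|² + (λ(ρ)/2)((div u)² + ε²(div v)²) ) = 0. -/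
open MeasureTheory

noncomputable section

/-- Periodicity with period `1` in each space direction: this models fields on the torus
`𝕋^d = (ℝ/ℤ)^d`. -/
def SpacePeriodic {d : ℕ} {α : Type*} (f : ℝ → Vec d → α) : Prop :=
  ∀ (t : ℝ) (x : Vec d) (k : Fin d → ℤ), f t (fun i => x i + (k i : ℝ)) = f t x

/-- Fundamental domain `[0,1]^d` of the torus. -/
def Box (d : ℕ) : Set (Vec d) := Set.Icc 0 1

/-- Smooth functions on `ℝ^d` that are `1`-periodic in each coordinate. -/
structure TorusSmooth {d : ℕ} (f : Vec d → ℝ) : Prop where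
  contDiff : ContDiff ℝ (⊤ : ℕ∞) f
  periodic : ∀ (x : Vec d) (k : Fin d → ℤ), f (fun i => x i + (k i : ℝ)) = f x

namespace TorusSmooth

variable {d : ℕ} {f g : Vec d → ℝ}

lemma differentiableAt (hf : TorusSmooth f) (x : Vec d) : DifferentiableAt ℝ f x :=
  (hf.contDiff.differentiable (by simp)) x

lemma add (hf : TorusSmooth f) (hg : TorusSmooth g) : TorusSmooth (fun x => f x + g x) :=
  ⟨hf.contDiff.add hg.contDiff, fun x k => by rw [hf.periodic, hg.periodic]⟩

lemma mul (hf : TorusSmooth f) (hg : TorusSmooth g) : TorusSmooth (fun x => f x * g x) :=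
  ⟨hf.contDiff.mul hg.contDiff, fun x k => by rw [hf.periodic, hg.periodic]⟩

lemma const_mul (hf : TorusSmooth f) (c : ℝ) : TorusSmooth (fun x => c * f x) :=
  ⟨contDiff_const.mul hf.contDiff, fun x k => by rw [hf.periodic]⟩

lemma sum {ι : Type*} [Fintype ι] {F : ι → Vec d → ℝ} (hF : ∀ i, TorusSmooth (F i)) :
    TorusSmooth (fun x => ∑ i, F i x) :=
  ⟨ContDiff.sum fun i _ => (hF i).contDiff,
    fun x k => Finset.sum_congr rfl fun i _ => (hF i).periodic x k⟩

lemma pd (hf : TorusSmooth f) (i : Fin d) : TorusSmooth (pd i f) := by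
  refine ⟨(hf.contDiff.fderiv_right (m := (⊤ : ℕ∞)) (by simp)).clm_apply contDiff_const,
    fun x k => ?_⟩
  have h : (fun y : Vec d => f (y + fun i => (k i : ℝ))) = f := funext fun y => hf.periodic y k
  have h2 := fderiv_comp_add_right (𝕜 := ℝ) (f := f) (x := x) (fun i => (k i : ℝ))
  rw [h] at h2
  simp only [_root_.pd]
  rw [h2]
  rfl

lemma rpow_const (hf : TorusSmooth f) (hpos : ∀ x, 0 < f x) (c : ℝ) :
    TorusSmooth (fun x => f x ^ c) :=
  ⟨hf.contDiff.rpow_const_of_ne fun x => (hpos x).ne', fun x k => by rw [hf.periodic]⟩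

lemma pd_add (hf : TorusSmooth f) (hg : TorusSmooth g) (i : Fin d) (x : Vec d) :
    _root_.pd i (fun y => f y + g y) x = _root_.pd i f x + _root_.pd i g x := by
  simp only [_root_.pd]
  rw [fderiv_fun_add (hf.differentiableAt x) (hg.differentiableAt x)]
  rfl

lemma pd_mul (hf : TorusSmooth f) (hg : TorusSmooth g) (i : Fin d) (x : Vec d) :
    _root_.pd i (fun y => f y * g y) x
      = _root_.pd i f x * g x + f x * _root_.pd i g x := by
  simp only [_root_.pd]
  rw [fderiv_fun_mul (hf.differentiableAt x) (hg.differentiableAt x)]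
  simp
  ring

lemma pd_const_mul (hf : TorusSmooth f) (c : ℝ) (i : Fin d) (x : Vec d) :
    _root_.pd i (fun y => c * f y) x = c * _root_.pd i f x := by
  simp only [_root_.pd]
  rw [fderiv_const_mul (hf.differentiableAt x)]
  rfl

lemma pd_sum {ι : Type*} [Fintype ι] {F : ι → Vec d → ℝ} (hF : ∀ i, TorusSmooth (F i))
    (i : Fin d) (x : Vec d) :
    _root_.pd i (fun y => ∑ j, F j y) x = ∑ j, _root_.pd i (F j) x := by
  simp only [_root_.pd]
  rw [fderiv_fun_sum fun j _ => (hF j).differentiableAt x]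
  simp

lemma pd_rpow_const (hf : TorusSmooth f) (hpos : ∀ x, 0 < f x) (c : ℝ) (i : Fin d) (x : Vec d) :
    _root_.pd i (fun y => f y ^ c) x = c * f x ^ (c - 1) * _root_.pd i f x := by
  simp only [_root_.pd]
  rw [((hf.differentiableAt x).hasFDerivAt.rpow_const (p := c) (Or.inl (hpos x).ne')).fderiv]
  rfl

lemma pd_comm (hf : TorusSmooth f) (i j : Fin d) (x : Vec d) :
    _root_.pd i (_root_.pd j f) x = _root_.pd j (_root_.pd i f) x := by
  have hd : DifferentiableAt ℝ (fderiv ℝ f) x :=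
    ((hf.contDiff.fderiv_right (m := (⊤ : ℕ∞)) (by simp)).differentiable (by simp)) x
  have key : ∀ k l : Fin d, _root_.pd k (_root_.pd l f) x
      = fderiv ℝ (fderiv ℝ f) x (Pi.single k 1) (Pi.single l 1) := by
    intro k l
    change fderiv ℝ (fun y => fderiv ℝ f y (Pi.single l 1)) x (Pi.single k 1) = _
    rw [fderiv_clm_apply hd (differentiableAt_const _)]
    simp
  rw [key, key]
  exact (hf.contDiff.contDiffAt.isSymmSndFDerivAt (n := (⊤ : ℕ∞))
    (by simp; exact WithTop.coe_le_coe.2 le_top)) _ _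

end TorusSmooth

/-- Functions that are the divergence of a smooth periodic vector field. -/
def IsTorusDivergence {d : ℕ} (f : Vec d → ℝ) : Prop :=
  ∃ F : Fin d → Vec d → ℝ, (∀ j, TorusSmooth (F j)) ∧ ∀ x, f x = ∑ j, pd j (F j) x

namespace IsTorusDivergence

variable {d : ℕ} {f g : Vec d → ℝ}

lemma add (hf : IsTorusDivergence f) (hg : IsTorusDivergence g) :
    IsTorusDivergence (fun x => f x + g x) := by
  obtain ⟨F, hF, hF'⟩ := hf
  obtain ⟨G, hG, hG'⟩ := hg
  refine ⟨fun j x => F j x + G j x, fun j => (hF j).add (hG j), fun x => ?_⟩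
  simp only [hF', hG', (hF _).pd_add (hG _), Finset.sum_add_distrib]

lemma const_mul (hf : IsTorusDivergence f) (c : ℝ) : IsTorusDivergence (fun x => c * f x) := by
  obtain ⟨F, hF, hF'⟩ := hf
  refine ⟨fun j x => c * F j x, fun j => (hF j).const_mul c, fun x => ?_⟩
  simp only [hF', (hF _).pd_const_mul, Finset.mul_sum]

lemma continuous (hf : IsTorusDivergence f) : Continuous f := by
  obtain ⟨F, hF, hF'⟩ := hf
  rw [funext hF']
  exact continuous_finsetSum _ fun j _ => ((hF j).pd j).contDiff.continuous

theorem integral_eq_zero (hf : IsTorusDivergence f) : ∫ x in Box d, f x = 0 := by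
  have hcont := hf.continuous
  obtain ⟨F, hF, hF'⟩ := hf
  rcases d with _ | n
  · simp [hF']
  have hint : IntegrableOn (fun x => ∑ j, fderiv ℝ (F j) x (Pi.single j 1))
      (Set.Icc (0 : Vec (n + 1)) 1) :=
    ((continuous_congr hF').1 hcont).continuousOn.integrableOn_compact isCompact_Icc
  have h := integral_divergence_of_hasFDerivAt_off_countable' (0 : Vec (n + 1)) 1 zero_le_one F
    (fun j x => fderiv ℝ (F j) x) ∅ Set.countable_empty
    (fun j => (hF j).contDiff.continuous.continuousOn)
    (fun x _ j => ((hF j).differentiableAt x).hasFDerivAt) hint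
  have h2 : ∫ x in Box (n + 1), f x
      = ∫ x in Set.Icc (0 : Vec (n + 1)) 1, ∑ j, fderiv ℝ (F j) x (Pi.single j 1) := by
    simp only [hF']; rfl
  rw [h2, h]
  refine Finset.sum_eq_zero fun j _ => sub_eq_zero.2 ?_
  congr 1
  funext y
  rw [← (hF j).periodic (Fin.insertNth j ((0 : Vec (n + 1)) j) y) (Pi.single j 1)]
  congr 1
  funext i
  rcases Fin.eq_self_or_eq_succAbove j i with rfl | ⟨k, rfl⟩
  · simp
  · simp

lemma sum_mul_pd {a : Fin d → Vec d → ℝ} {S : Fin d → Fin d → Vec d → ℝ}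
    (ha : ∀ i, TorusSmooth (a i)) (hS : ∀ i j, TorusSmooth (S i j)) :
    IsTorusDivergence (fun x => (∑ i, a i x * ∑ j, pd j (S i j) x)
      + ∑ i, ∑ j, pd j (a i) x * S i j x) := by
  refine ⟨fun j x => ∑ i, a i x * S i j x,
    fun j => TorusSmooth.sum fun i => (ha i).mul (hS i j), fun x => ?_⟩
  have h : ∀ j, pd j (fun x => ∑ i, a i x * S i j x) x
      = ∑ i, (pd j (a i) x * S i j x + a i x * pd j (S i j) x) := fun j => by
    rw [TorusSmooth.pd_sum fun i => (ha i).mul (hS i j)]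
    exact Finset.sum_congr rfl fun i _ => (ha i).pd_mul (hS i j) j x
  simp only [h]
  conv_rhs => rw [Finset.sum_comm]
  rw [← Finset.sum_add_distrib]
  refine Finset.sum_congr rfl fun i _ => ?_
  rw [Finset.sum_add_distrib, Finset.mul_sum, add_comm]

lemma sum_mul_pd_scalar {a : Fin d → Vec d → ℝ} {q : Vec d → ℝ}
    (ha : ∀ i, TorusSmooth (a i)) (hq : TorusSmooth q) :
    IsTorusDivergence (fun x => (∑ i, a i x * pd i q x) + q x * ∑ i, pd i (a i) x) := by
  refine ⟨fun j x => a j x * q x, fun j => (ha j).mul hq, fun x => ?_⟩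
  simp only [(ha _).pd_mul hq, Finset.sum_add_distrib, ← Finset.sum_mul]
  ring

end IsTorusDivergence

/-- Differentiation under the integral sign over the unit box. -/
theorem hasDerivAt_integral_box {d : ℕ} {E : ℝ → Vec d → ℝ}
    (hE : ContDiff ℝ 1 (fun p : ℝ × Vec d => E p.1 p.2)) (t : ℝ) :
    HasDerivAt (fun τ => ∫ x in Box d, E τ x)
      (∫ x in Box d, deriv (fun τ => E τ x) t) t := by
  set g : ℝ × Vec d → ℝ := fun p => E p.1 p.2
  have hder : ∀ τ x, HasDerivAt (fun σ => E σ x) (fderiv ℝ g (τ, x) (1, 0)) τ := fun τ x =>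
    ((hE.differentiable one_ne_zero (τ, x)).hasFDerivAt.comp_hasDerivAt τ
      ((hasDerivAt_id τ).prodMk (hasDerivAt_const τ x)) :)
  have hcont : Continuous fun p : ℝ × Vec d => fderiv ℝ g p (1, 0) :=
    (hE.continuous_fderiv one_ne_zero).clm_apply continuous_const
  have hK : IsCompact (Set.Icc (t - 1) (t + 1) ×ˢ Box d) := isCompact_Icc.prod isCompact_Icc
  obtain ⟨C, hC⟩ := hK.exists_bound_of_continuousOn hcont.continuousOn
  have hfin : IsFiniteMeasure (volume.restrict (Box d)) :=
    ⟨by simpa using (show IsCompact (Box d) from isCompact_Icc).measure_lt_top⟩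
  have hEc : ∀ τ, Continuous (E τ) := fun τ =>
    hE.continuous.comp (Continuous.prodMk_right τ)
  have h := (hasDerivAt_integral_of_dominated_loc_of_deriv_le (μ := volume.restrict (Box d))
    (F := E) (F' := fun τ x => fderiv ℝ g (τ, x) (1, 0)) (x₀ := t) (bound := fun _ => C)
    (Icc_mem_nhds (a := t - 1) (b := t + 1) (by linarith) (by linarith))
    (Filter.Eventually.of_forall fun τ => (hEc τ).aestronglyMeasurable)
    ((hEc t).continuousOn.integrableOn_compact isCompact_Icc)
    (hcont.comp (Continuous.prodMk_right t)).aestronglyMeasurable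
    ((ae_restrict_iff' measurableSet_Icc).2 <| Filter.Eventually.of_forall
      fun x hx τ hτ => hC (τ, x) ⟨hτ, hx⟩)
    (integrable_const C)
    (Filter.Eventually.of_forall fun x τ _ => hder τ x)).2
  simpa only [(hder t _).deriv] using h

/-- Time and space derivatives of a smooth function commute. -/
theorem hasDerivAt_pd {d : ℕ} {f : ℝ → Vec d → ℝ}
    (hf : ContDiff ℝ (⊤ : ℕ∞) (fun p : ℝ × Vec d => f p.1 p.2)) (i : Fin d) (t : ℝ) (x : Vec d) :
    HasDerivAt (fun τ => pd i (f τ) x) (pd i (fun y => deriv (fun τ => f τ y) t) x) t := by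
  set g : ℝ × Vec d → ℝ := fun p => f p.1 p.2
  have hg : Differentiable ℝ g := hf.differentiable (by simp)
  have hg' : Differentiable ℝ (fderiv ℝ g) :=
    (hf.fderiv_right (m := (⊤ : ℕ∞)) (by simp)).differentiable (by simp)
  have ht : ∀ τ y, deriv (fun σ => f σ y) τ = fderiv ℝ g (τ, y) (1, 0) := fun τ y =>
    HasDerivAt.deriv ((hg (τ, y)).hasFDerivAt.comp_hasDerivAt τ
      ((hasDerivAt_id τ).prodMk (hasDerivAt_const τ y)) :)
  have hx : ∀ τ, pd i (f τ) x = fderiv ℝ g (τ, x) (0, Pi.single i 1) := fun τ => by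
    have h := (hg (τ, x)).hasFDerivAt.comp x
      ((hasFDerivAt_const τ x).prodMk (hasFDerivAt_id x))
    have h' : HasFDerivAt (f τ) _ x := h
    rw [pd, h'.fderiv]
    simp
  have hxt : pd i (fun y => deriv (fun τ => f τ y) t) x
      = fderiv ℝ (fderiv ℝ g) (t, x) (0, Pi.single i 1) (1, 0) := by
    simp only [ht]
    have h := ((hg' (t, x)).hasFDerivAt.comp x
      ((hasFDerivAt_const t x).prodMk (hasFDerivAt_id x))).clm_apply
        (hasFDerivAt_const ((1 : ℝ), (0 : Vec d)) x)
    have h' : HasFDerivAt (fun y => fderiv ℝ g (t, y) (1, 0)) _ x := h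
    rw [pd, h'.fderiv]
    simp
  rw [hxt, (hf.contDiffAt.isSymmSndFDerivAt (n := (⊤ : ℕ∞))
    (by simp; exact WithTop.coe_le_coe.2 le_top)) (0, Pi.single i 1) (1, 0)]
  simp only [hx]
  have h0 : HasDerivAt (fun τ : ℝ => (τ, x)) ((1 : ℝ), (0 : Vec d)) t :=
    (hasDerivAt_id t).prodMk (hasDerivAt_const t x)
  have h1 : HasDerivAt (fun τ => fderiv ℝ g (τ, x)) (fderiv ℝ (fderiv ℝ g) (t, x) (1, 0)) t :=
    (hg' (t, x)).hasFDerivAt.comp_hasDerivAt t h0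
  simpa using h1.clm_apply (hasDerivAt_const t ((0 : ℝ), (Pi.single i 1 : Vec d)))

section Slice

variable {d : ℕ} {r M L k : Vec d → ℝ} {u v : Fin d → Vec d → ℝ}

/-- A weighted gradient `v = k ∇r / r` with `r v = ∇M` is curl free. -/
theorem pd_drift_symm (hr : TorusSmooth r) (hpos : ∀ x, 0 < r x) (hM : TorusSmooth M)
    (hv : ∀ i, TorusSmooth (v i)) (hMv : ∀ i x, pd i M x = r x * v i x)
    (hk : ∀ i x, r x * v i x = k x * pd i r x) (i j : Fin d) (x : Vec d) :
    pd j (v i) x = pd i (v j) x := by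
  have h : ∀ i j, pd j (pd i M) x = pd j r x * v i x + r x * pd j (v i) x := fun i j => by
    rw [show pd i M = fun y => r y * v i y from funext (hMv i), hr.pd_mul (hv i)]
  have hc := hM.pd_comm j i x
  rw [h, h] at hc
  have hr0 := (hpos x).ne'
  have h1 : pd j r x * v i x = pd i r x * v j x := by
    apply mul_left_cancel₀ hr0
    linear_combination pd j r x * hk i x - pd i r x * hk j x
  apply mul_left_cancel₀ hr0
  linear_combination hc - h1

/-- Conservative form of the time derivative of a gradient-weighted momentum. -/
theorem pd_mul_neg_div (hr : TorusSmooth r) (hM : TorusSmooth M) (hL : TorusSmooth L)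
    (hu : ∀ i, TorusSmooth (u i)) (hv : ∀ i, TorusSmooth (v i))
    (hMv : ∀ i x, pd i M x = r x * v i x)
    (hk : ∀ i x, r x * v i x = k x * pd i r x)
    (hLk : ∀ x, L x = 2 * (r x * k x - M x)) (i : Fin d) (x : Vec d) :
    pd i (fun y => k y * -∑ j, pd j (fun z => r z * u j z) y) x
      = -((∑ j, pd j (fun y => r y * v i y * u j y) x)
        + (∑ j, pd j (fun y => M y * pd i (u j) y) x)
        + (1 / 2) * pd i (fun y => L y * ∑ j, pd j (u j) y) x) := by
  have hMu : ∀ j, TorusSmooth (fun y => M y * u j y) := fun j => hM.mul (hu j)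
  have hdiv : TorusSmooth (fun y => ∑ j, pd j (u j) y) := TorusSmooth.sum fun j => (hu j).pd j
  have h1 : (fun y => k y * -∑ j, pd j (fun z => r z * u j z) y)
      = fun y => (-1) * ((∑ j, pd j (fun z => M z * u j z) y)
        + (1 / 2) * (L y * ∑ j, pd j (u j) y)) := by
    funext y
    have h2 : ∀ j, k y * pd j (fun z => r z * u j z) y
        = pd j (fun z => M z * u j z) y + (1 / 2) * (L y * pd j (u j) y) := fun j => by
      rw [hr.pd_mul (hu j), hM.pd_mul (hu j), hLk, hMv, hk]
      ring
    simp only [mul_neg, Finset.mul_sum, h2, Finset.sum_add_distrib]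
    ring
  have h3 : ∀ j, pd i (pd j (fun z => M z * u j z)) x
      = pd j (fun y => r y * v i y * u j y) x + pd j (fun y => M y * pd i (u j) y) x := fun j => by
    rw [(hMu j).pd_comm, show pd i (fun z => M z * u j z)
      = fun y => r y * v i y * u j y + M y * pd i (u j) y from
        funext fun y => by rw [hM.pd_mul (hu j), hMv]]
    exact ((hr.mul (hv i)).mul (hu j)).pd_add (hM.mul ((hu j).pd i)) j x
  rw [h1, ((TorusSmooth.sum fun j => (hMu j).pd j).add
      ((hL.mul hdiv).const_mul (1 / 2))).pd_const_mul,
    (TorusSmooth.sum fun j => (hMu j).pd j).pd_add ((hL.mul hdiv).const_mul (1 / 2)),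
    TorusSmooth.pd_sum (fun j => (hMu j).pd j), (hL.mul hdiv).pd_const_mul]
  simp only [h3, Finset.sum_add_distrib]
  ring

/-- Kinetic energy balance of a transported momentum `r a`, up to a divergence. -/
theorem isTorusDivergence_kinetic {a : Fin d → Vec d → ℝ} {rt : Vec d → ℝ}
    {at' G : Fin d → Vec d → ℝ}
    (hr : TorusSmooth r) (hu : ∀ i, TorusSmooth (u i)) (ha : ∀ i, TorusSmooth (a i))
    (hrt : ∀ x, rt x = -∑ j, pd j (fun y => r y * u j y) x)
    (hG : ∀ i x, rt x * a i x + r x * at' i x + ∑ j, pd j (fun y => r y * a i y * u j y) x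
      = G i x) :
    IsTorusDivergence (fun x => (1 / 2) * rt x * (∑ i, a i x ^ 2) + r x * (∑ i, a i x * at' i x)
      - ∑ i, a i x * G i x) := by
  have hm : ∀ j, TorusSmooth (fun y => r y * u j y) := fun j => hr.mul (hu j)
  have hq : TorusSmooth (fun y => ∑ i, a i y * a i y) := TorusSmooth.sum fun i => (ha i).mul (ha i)
  have hdiv := (IsTorusDivergence.sum_mul_pd_scalar hm hq).const_mul (-(1 / 2))
  convert hdiv using 1
  funext x
  have h1 : ∀ j, pd j (fun y => ∑ i, a i y * a i y) x = ∑ i, 2 * (a i x * pd j (a i) x) :=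
    fun j => by
      rw [TorusSmooth.pd_sum fun i => (ha i).mul (ha i)]
      exact Finset.sum_congr rfl fun i _ => by rw [(ha i).pd_mul (ha i)]; ring
  have h2 : ∀ i, a i x * G i x = rt x * (a i x * a i x) + r x * (a i x * at' i x)
      + (∑ j, a i x * pd j (a i) x * (r x * u j x))
      + (∑ j, pd j (fun y => r y * u j y) x) * (a i x * a i x) := fun i => by
    have h3 : ∀ j, pd j (fun y => r y * a i y * u j y) x
        = pd j (a i) x * (r x * u j x) + a i x * pd j (fun y => r y * u j y) x := fun j => by
      rw [show (fun y => r y * a i y * u j y) = fun y => a i y * (r y * u j y) from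
        funext fun y => by ring, (ha i).pd_mul (hm j)]
    have h5 : ∑ j, a i x * pd j (a i) x * (r x * u j x)
        = a i x * ∑ j, pd j (a i) x * (r x * u j x) := by simp only [Finset.mul_sum, mul_assoc]
    rw [← hG, Finset.sum_congr rfl fun j _ => h3 j, Finset.sum_add_distrib, ← Finset.mul_sum, h5]
    ring
  have h4 : ∑ j, r x * u j x * ∑ i, 2 * (a i x * pd j (a i) x)
      = 2 * ∑ i, ∑ j, a i x * pd j (a i) x * (r x * u j x) := by
    simp only [Finset.mul_sum]
    rw [Finset.sum_comm]
    exact Finset.sum_congr rfl fun i _ => Finset.sum_congr rfl fun j _ => by ring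
  rw [Finset.sum_congr rfl fun j _ => congrArg (r x * u j x * ·) (h1 j), h4]
  simp only [h2, Finset.sum_add_distrib, ← Finset.mul_sum, pow_two]
  rw [hrt]
  ring

/-- The entropy production is, up to a divergence, minus the time derivative of the entropy. -/
theorem isTorusDivergence_entropy {rt : Vec d → ℝ} {ut vt : Fin d → Vec d → ℝ} {ν ε γ : ℝ}
    (hγ : 1 < γ)
    (hr : TorusSmooth r) (hpos : ∀ x, 0 < r x) (hM : TorusSmooth M) (hL : TorusSmooth L)
    (hu : ∀ i, TorusSmooth (u i)) (hv : ∀ i, TorusSmooth (v i))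
    (hMv : ∀ i x, pd i M x = r x * v i x)
    (hk : ∀ i x, r x * v i x = k x * pd i r x)
    (hrt : ∀ x, rt x = -∑ j, pd j (fun y => r y * u j y) x)
    (hut : ∀ i x, rt x * u i x + r x * ut i x + (∑ j, pd j (fun y => r y * u i y * u j y) x)
      + pd i (fun y => r y ^ γ) x
      - 2 * ν * (∑ j, pd j (fun y => M y * ((1 / 2) * (pd j (u i) y + pd i (u j) y))) x)
      - ν * pd i (fun y => L y * ∑ j, pd j (u j) y) x
      = ε ^ 2 * ((∑ j, pd j (fun y => M y * pd i (v j) y) x)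
        + (1 / 2) * pd i (fun y => L y * ∑ j, pd j (v j) y) x))
    (hvt : ∀ i x, rt x * v i x + r x * vt i x
      = -((∑ j, pd j (fun y => r y * v i y * u j y) x)
        + (∑ j, pd j (fun y => M y * pd i (u j) y) x)
        + (1 / 2) * pd i (fun y => L y * ∑ j, pd j (u j) y) x)) :
    IsTorusDivergence (fun x =>
      (ν ^ 2 + ε ^ 2) * ((1 / 2) * rt x * (∑ i, v i x ^ 2) + r x * (∑ i, v i x * vt i x))
      + ((1 / 2) * rt x * (∑ i, (u i x + ν * v i x) ^ 2)
        + r x * (∑ i, (u i x + ν * v i x) * (ut i x + ν * vt i x)))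
      + γ / (γ - 1) * r x ^ (γ - 1) * rt x
      + ν * (M x * ((∑ i, ∑ j, pd j (u i) x ^ 2) + ε ^ 2 * (∑ i, ∑ j, pd j (v i) x ^ 2))
        + k x * (γ * r x ^ (γ - 2)) * (∑ i, pd i r x ^ 2)
        + (L x / 2) * ((∑ i, pd i (u i) x) ^ 2 + ε ^ 2 * (∑ i, pd i (v i) x) ^ 2))) := by
  have hsymm := pd_drift_symm hr hpos hM hv hMv hk
  set w : Fin d → Vec d → ℝ := fun i x => u i x + ν * v i x with hw_def
  have hw : ∀ i, TorusSmooth (w i) := fun i => (hu i).add ((hv i).const_mul ν)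
  have hpw : ∀ i j x, pd j (w i) x = pd j (u i) x + ν * pd j (v i) x := fun i j x => by
    rw [hw_def, (hu i).pd_add ((hv i).const_mul ν), (hv i).pd_const_mul]
  have hdu : TorusSmooth (fun y => ∑ j, pd j (u j) y) := TorusSmooth.sum fun j => (hu j).pd j
  have hdv : TorusSmooth (fun y => ∑ j, pd j (v j) y) := TorusSmooth.sum fun j => (hv j).pd j
  set S₁ : Fin d → Vec d → ℝ := fun i x => ∑ j, pd j (fun y => M y * pd j (u i) y) x with hS₁
  set S₂ : Fin d → Vec d → ℝ := fun i x => ∑ j, pd j (fun y => M y * pd i (u j) y) x with hS₂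
  set S₃ : Fin d → Vec d → ℝ := fun i x => ∑ j, pd j (fun y => M y * pd i (v j) y) x with hS₃
  set q₁ : Vec d → ℝ := fun y => L y * ∑ j, pd j (u j) y with hq₁
  set q₂ : Vec d → ℝ := fun y => L y * ∑ j, pd j (v j) y with hq₂
  have hstress : ∀ i x,
      2 * ν * (∑ j, pd j (fun y => M y * ((1 / 2) * (pd j (u i) y + pd i (u j) y))) x)
        = ν * (S₁ i x + S₂ i x) := fun i x => by
    have h : ∀ j, pd j (fun y => M y * ((1 / 2) * (pd j (u i) y + pd i (u j) y))) x
        = (1 / 2) * (pd j (fun y => M y * pd j (u i) y) x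
          + pd j (fun y => M y * pd i (u j) y) x) := fun j => by
      rw [← (hM.mul ((hu i).pd j)).pd_add (hM.mul ((hu j).pd i)),
        ← ((hM.mul ((hu i).pd j)).add (hM.mul ((hu j).pd i))).pd_const_mul]
      congr 1
      funext y
      ring
    simp only [h, ← Finset.mul_sum, Finset.sum_add_distrib, hS₁, hS₂]
    ring
  have Nv := isTorusDivergence_kinetic (at' := vt) (G := fun i x => -(S₂ i x + (1 / 2) * pd i q₁ x))
    hr hu hv hrt fun i x => by linear_combination hvt i x
  have Nw := isTorusDivergence_kinetic (at' := fun i x => ut i x + ν * vt i x)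
    (G := fun i x => -pd i (fun y => r y ^ γ) x + ν * S₁ i x + ν / 2 * pd i q₁ x
      + ε ^ 2 * (S₃ i x + (1 / 2) * pd i q₂ x)) hr hu hw hrt fun i x => by
    have h : ∀ j, pd j (fun y => r y * w i y * u j y) x
        = pd j (fun y => r y * u i y * u j y) x + ν * pd j (fun y => r y * v i y * u j y) x :=
      fun j => by
        rw [← ((hr.mul (hv i)).mul (hu j)).pd_const_mul,
          ← ((hr.mul (hu i)).mul (hu j)).pd_add (((hr.mul (hv i)).mul (hu j)).const_mul ν)]
        congr 1
        funext y
        simp only [hw_def]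
        ring
    rw [Finset.sum_congr rfl fun j _ => h j, Finset.sum_add_distrib, ← Finset.mul_sum]
    linear_combination hut i x + ν * hvt i x + hstress i x
  have N₁ := IsTorusDivergence.sum_mul_pd hw fun i j => hM.mul ((hu i).pd j)
  have N₂ := IsTorusDivergence.sum_mul_pd hv fun i j => hM.mul ((hu j).pd i)
  have N₃ := IsTorusDivergence.sum_mul_pd hw fun i j => hM.mul ((hv j).pd i)
  have Q₁w := IsTorusDivergence.sum_mul_pd_scalar hw (hL.mul hdu)
  have Q₁v := IsTorusDivergence.sum_mul_pd_scalar hv (hL.mul hdu)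
  have Q₂w := IsTorusDivergence.sum_mul_pd_scalar hw (hL.mul hdv)
  have NH := IsTorusDivergence.sum_mul_pd_scalar (fun i => hr.mul (hu i))
    ((hr.rpow_const hpos (γ - 1)).const_mul (γ / (γ - 1)))
  have total := ((((((((Nv.const_mul (ν ^ 2 + ε ^ 2)).add Nw).add (N₁.const_mul ν)).add
    (N₂.const_mul (-(ν ^ 2 + ε ^ 2)))).add (N₃.const_mul (ε ^ 2))).add
    (Q₁w.const_mul (ν / 2))).add (Q₁v.const_mul (-(ν ^ 2 + ε ^ 2) / 2))).add
    (Q₂w.const_mul (ε ^ 2 / 2))).add (NH.const_mul (-1))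
  convert total using 1
  funext x
  have hr0 := (hpos x).ne'
  have hpress : ∀ i, pd i (fun y => r y ^ γ) x = γ * r x ^ (γ - 1) * pd i r x :=
    fun i => hr.pd_rpow_const hpos γ i x
  have hH : ∀ i, r x * u i x * pd i (fun y => γ / (γ - 1) * r y ^ (γ - 1)) x
      = u i x * pd i (fun y => r y ^ γ) x := fun i => by
    have hγ' : γ - 1 ≠ 0 := by linarith
    rw [(hr.rpow_const hpos (γ - 1)).pd_const_mul, hr.pd_rpow_const hpos, hpress,
      Real.rpow_sub_one hr0 (γ - 1)]
    field_simp
  have hvp : ∀ i, v i x * pd i (fun y => r y ^ γ) x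
      = k x * (γ * r x ^ (γ - 2)) * pd i r x ^ 2 := fun i => by
    rw [hpress, show γ - 2 = γ - 1 - 1 by ring, Real.rpow_sub_one hr0 (γ - 1)]
    field_simp
    linear_combination r x ^ (γ - 1) * pd i r x * hk i x
  have hX₁ : ∑ i, ∑ j, pd j (w i) x * (M x * pd j (u i) x)
      = M x * ((∑ i, ∑ j, pd j (u i) x ^ 2) + ν * ∑ i, ∑ j, pd j (u i) x * pd j (v i) x) := by
    simp only [hpw, Finset.mul_sum, ← Finset.sum_add_distrib, mul_add]
    exact Finset.sum_congr rfl fun i _ => Finset.sum_congr rfl fun j _ => by ring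
  have hX₂ : ∑ i, ∑ j, pd j (v i) x * (M x * pd i (u j) x)
      = M x * ∑ i, ∑ j, pd j (u i) x * pd j (v i) x := by
    rw [Finset.sum_comm]
    simp only [Finset.mul_sum]
    exact Finset.sum_congr rfl fun i _ => Finset.sum_congr rfl fun j _ => by
      rw [hsymm j i]; ring
  have hX₃ : ∑ i, ∑ j, pd j (w i) x * (M x * pd i (v j) x)
      = M x * ((∑ i, ∑ j, pd j (u i) x * pd j (v i) x) + ν * ∑ i, ∑ j, pd j (v i) x ^ 2) := by
    simp only [hpw, Finset.mul_sum, ← Finset.sum_add_distrib, mul_add]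
    exact Finset.sum_congr rfl fun i _ => Finset.sum_congr rfl fun j _ => by
      rw [← hsymm i j]; ring
  have hwp : ∑ i, w i x * pd i (fun y => r y ^ γ) x
      = (∑ i, u i x * pd i (fun y => r y ^ γ) x)
        + ν * (k x * (γ * r x ^ (γ - 2)) * ∑ i, pd i r x ^ 2) := by
    simp only [Finset.mul_sum, ← Finset.sum_add_distrib]
    exact Finset.sum_congr rfl fun i _ => by rw [← hvp, hw_def]; ring
  have hGv : ∑ i, v i x * -(S₂ i x + (1 / 2) * pd i q₁ x)
      = -(∑ i, v i x * S₂ i x) - (1 / 2) * ∑ i, v i x * pd i q₁ x := by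
    simp only [Finset.mul_sum, ← Finset.sum_neg_distrib, ← Finset.sum_sub_distrib]
    exact Finset.sum_congr rfl fun i _ => by ring
  have hGw : ∑ i, w i x * (-pd i (fun y => r y ^ γ) x + ν * S₁ i x + ν / 2 * pd i q₁ x
        + ε ^ 2 * (S₃ i x + (1 / 2) * pd i q₂ x))
      = -(∑ i, w i x * pd i (fun y => r y ^ γ) x) + ν * (∑ i, w i x * S₁ i x)
        + ν / 2 * (∑ i, w i x * pd i q₁ x)
        + ε ^ 2 * (∑ i, w i x * S₃ i x) + ε ^ 2 / 2 * ∑ i, w i x * pd i q₂ x := by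
    simp only [Finset.mul_sum, ← Finset.sum_neg_distrib, ← Finset.sum_add_distrib]
    exact Finset.sum_congr rfl fun i _ => by ring
  have hdw : ∑ i, pd i (w i) x = (∑ i, pd i (u i) x) + ν * ∑ i, pd i (v i) x := by
    simp only [hpw, Finset.sum_add_distrib, Finset.mul_sum]
  simp only [hH]
  rw [hGv, hGw, hX₁, hX₂, hX₃, hdw, hwp, hrt]
  simp only [hq₁, hq₂, hS₁, hS₂, hS₃, hw_def]
  ring

end Slice

/-- A time slice of a smooth, space periodic field is smooth on the torus. -/
theorem torusSmooth_slice {d : ℕ} {f : ℝ → Vec d → ℝ}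
    (hf : ContDiff ℝ (⊤ : ℕ∞) (fun p : ℝ × Vec d => f p.1 p.2)) (hper : SpacePeriodic f) (t : ℝ) :
    TorusSmooth (f t) :=
  ⟨hf.comp (contDiff_const.prodMk contDiff_id), hper t⟩

/-- Differentiability in time of a smooth field. -/
theorem hasDerivAt_time {d : ℕ} {f : ℝ → Vec d → ℝ}
    (hf : ContDiff ℝ (⊤ : ℕ∞) (fun p : ℝ × Vec d => f p.1 p.2)) (t : ℝ) (x : Vec d) :
    HasDerivAt (fun τ => f τ x) (deriv (fun τ => f τ x) t) t :=
  (((hf.comp (contDiff_id.prodMk contDiff_const)).differentiable (by simp) :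
    Differentiable ℝ fun τ => f τ x) t).hasDerivAt

/-- Time derivative of `ρ v`, where `ρ v = k(ρ) ∇ρ` on a time interval. -/
theorem deriv_mul_drift {d : ℕ} {T c : ℝ} (hT : 0 < T) {ρ w : ℝ → Vec d → ℝ}
    (hρs : ContDiff ℝ (⊤ : ℕ∞) (fun p : ℝ × Vec d => ρ p.1 p.2))
    (hws : ContDiff ℝ (⊤ : ℕ∞) (fun p : ℝ × Vec d => w p.1 p.2))
    (hρper : SpacePeriodic ρ) (hρpos : ∀ t ∈ Set.Icc 0 T, ∀ x, 0 < ρ t x) (i : Fin d)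
    (hw : ∀ t ∈ Set.Icc 0 T, ∀ x, ρ t x * w t x = c * ρ t x ^ (c - 1) * pd i (ρ t) x)
    {t : ℝ} (ht : t ∈ Set.Icc 0 T)
    (hRt : TorusSmooth fun y => deriv (fun τ => ρ τ y) t) (x : Vec d) :
    deriv (fun τ => ρ τ x) t * w t x + ρ t x * deriv (fun τ => w τ x) t
      = pd i (fun y => c * ρ t y ^ (c - 1) * deriv (fun τ => ρ τ y) t) x := by
  have hr := torusSmooth_slice hρs hρper t
  have hρ' := hasDerivAt_time hρs t x
  have h1 := (hρ'.mul (hasDerivAt_time hws t x)).hasDerivWithinAt (s := Set.Icc 0 T)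
  have h2 := (((hρ'.rpow_const (p := c - 1) (Or.inl (hρpos t ht x).ne')).const_mul c).mul
    (hasDerivAt_pd hρs i t x)).hasDerivWithinAt (s := Set.Icc 0 T)
  have h3 := h2.congr (fun τ hτ => hw τ hτ x) (hw t ht x)
  rw [(uniqueDiffOn_Icc hT t ht).eq_deriv _ h1 h3,
    ((hr.rpow_const (hρpos t ht) (c - 1)).const_mul c).pd_mul hRt,
    (hr.rpow_const (hρpos t ht) (c - 1)).pd_const_mul, hr.pd_rpow_const (hρpos t ht)]
  ring

/-- The BD (κ = 1/2) entropy equality for smooth solutions of the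
Navier–Stokes–Korteweg system on the torus: with `v = ∇(μ∘ρ)/ρ`, `w = u + νv`,
`μ(ρ) = ρ^((s+3)/2)`, `λ(ρ) = 2(ρμ'(ρ) − μ(ρ))`, `p(ρ) = ρ^γ`, `H(ρ) = ρ^γ/(γ−1)`,
`H''(ρ) = γρ^(γ−2)`,
`(d/dt)∫(((ν²+ε²)/2)ρ|v|² + ½ρ|w|² + H(ρ))
  + ν∫(μ(ρ)(|∇u|² + ε²|∇v|²) + μ'(ρ)H''(ρ)|∇ρ|² + (λ(ρ)/2)((div u)² + ε²(div v)²)) = 0`. -/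
theorem nsk_bd_entropy_equality
    (d : ℕ) (hd1 : 1 ≤ d) (hd3 : d ≤ 3)
    (T ε ν γ s : ℝ) (hT : 0 < T) (hε : 0 < ε) (hν : 0 < ν) (hγ : 1 < γ) (hs : -1 ≤ s)
    (ρ : ℝ → Vec d → ℝ) (u v : ℝ → Vec d → Vec d)
    (hρs : ContDiff ℝ (⊤ : ℕ∞) (fun p : ℝ × Vec d => ρ p.1 p.2))
    (hus : ContDiff ℝ (⊤ : ℕ∞) (fun p : ℝ × Vec d => u p.1 p.2))
    (hvs : ContDiff ℝ (⊤ : ℕ∞) (fun p : ℝ × Vec d => v p.1 p.2))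
    (hρper : SpacePeriodic ρ) (huper : SpacePeriodic u) (hvper : SpacePeriodic v)
    (hρpos : ∀ t ∈ Set.Icc 0 T, ∀ x, 0 < ρ t x)
    (μ muD lam : ℝ → ℝ)
    (hμ : ∀ z : ℝ, μ z = z ^ ((s + 3) / 2))
    (hmuD : ∀ z : ℝ, muD z = ((s + 3) / 2) * z ^ ((s + 1) / 2))
    (hlam : ∀ z : ℝ, lam z = 2 * (z * muD z - μ z))
    -- definition of the drift velocity `v = ∇(μ∘ρ)/ρ`
    (hv : ∀ t ∈ Set.Icc 0 T, ∀ x i, v t x i = pd i (fun y => μ (ρ t y)) x / ρ t x)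
    -- mass equation `∂ₜρ + div(ρu) = 0`
    (hmass : ∀ t ∈ Set.Icc 0 T, ∀ x,
      deriv (fun τ => ρ τ x) t + (∑ i, pd i (fun y => ρ t y * u t y i) x) = 0)
    -- momentum equation `∂ₜ(ρu) + div(ρu⊗u) + ∇p(ρ) − 2ν div(μ(ρ)D(u)) − ν∇(λ(ρ)div u)
    --   = ε²[div(μ(ρ)ᵗ∇v) + ½∇(λ(ρ)div v)]` with `D(u) = ½(∇u + ᵗ∇u)`
    (hmom : ∀ t ∈ Set.Icc 0 T, ∀ x, ∀ i,
      deriv (fun τ => ρ τ x * u τ x i) t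
          + (∑ j, pd j (fun y => ρ t y * u t y i * u t y j) x)
          + pd i (fun y => ρ t y ^ γ) x
          - 2 * ν * (∑ j, pd j (fun y => μ (ρ t y)
              * ((1 / 2) * (pd j (fun z => u t z i) y + pd i (fun z => u t z j) y))) x)
          - ν * pd i (fun y => lam (ρ t y) * ∑ j, pd j (fun z => u t z j) y) x
        = ε ^ 2 * ((∑ j, pd j (fun y => μ (ρ t y) * pd i (fun z => v t z j) y) x)
            + (1 / 2) * pd i (fun y =>
                lam (ρ t y) * ∑ j, pd j (fun z => v t z j) y) x)) :
    ∀ t ∈ Set.Icc 0 T,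
      HasDerivWithinAt
        (fun τ => ∫ x in Box d,
          (((ν ^ 2 + ε ^ 2) / 2) * ρ τ x * (∑ i, (v τ x i) ^ 2)
            + (1 / 2) * ρ τ x * (∑ i, (u τ x i + ν * v τ x i) ^ 2)
            + ρ τ x ^ γ / (γ - 1)))
        (-(ν * ∫ x in Box d,
          (μ (ρ t x) * ((∑ i, ∑ j, (pd j (fun y => u t y i) x) ^ 2)
              + ε ^ 2 * (∑ i, ∑ j, (pd j (fun y => v t y i) x) ^ 2))
            + muD (ρ t x) * (γ * ρ t x ^ (γ - 2)) * (∑ i, (pd i (fun y => ρ t y) x) ^ 2)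
            + (lam (ρ t x) / 2) * ((∑ i, pd i (fun y => u t y i) x) ^ 2
                + ε ^ 2 * (∑ i, pd i (fun y => v t y i) x) ^ 2))))
        (Set.Icc 0 T) t := by
  intro t ht
  have hper : ∀ {a : ℝ → Vec d → Vec d}, SpacePeriodic a → ∀ i,
      SpacePeriodic fun τ x => a τ x i := fun h i τ x k => congrFun (h τ x k) i
  have hui : ∀ i, ContDiff ℝ (⊤ : ℕ∞) (fun p : ℝ × Vec d => u p.1 p.2 i) := contDiff_pi.1 hus
  have hvi : ∀ i, ContDiff ℝ (⊤ : ℕ∞) (fun p : ℝ × Vec d => v p.1 p.2 i) := contDiff_pi.1 hvs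
  have hpos := hρpos t ht
  have hr := torusSmooth_slice hρs hρper t
  have hu : ∀ i, TorusSmooth fun y => u t y i := fun i =>
    torusSmooth_slice (hui i) (hper huper i) t
  have hv' : ∀ i, TorusSmooth fun y => v t y i := fun i =>
    torusSmooth_slice (hvi i) (hper hvper i) t
  have hmuD' : ∀ z, muD z = (s + 3) / 2 * z ^ ((s + 3) / 2 - 1) := fun z => by
    rw [hmuD, show (s + 1) / 2 = (s + 3) / 2 - 1 by ring]
  have hM : TorusSmooth fun y => μ (ρ t y) := by
    simpa only [hμ] using hr.rpow_const hpos ((s + 3) / 2)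
  have hk : TorusSmooth fun y => muD (ρ t y) := by
    simpa only [hmuD'] using (hr.rpow_const hpos ((s + 3) / 2 - 1)).const_mul ((s + 3) / 2)
  have hL : TorusSmooth fun y => lam (ρ t y) := by
    convert ((hr.mul hk).add (hM.const_mul (-1))).const_mul 2 using 2 with y
    rw [hlam]
    ring
  have hgrad : ∀ τ ∈ Set.Icc 0 T, ∀ i x,
      pd i (fun y => μ (ρ τ y)) x = ρ τ x * v τ x i := fun τ hτ i x => by
    rw [hv τ hτ, mul_div_cancel₀ _ (hρpos τ hτ x).ne']
  have hdrift : ∀ τ ∈ Set.Icc 0 T, ∀ i x,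
      ρ τ x * v τ x i = muD (ρ τ x) * pd i (ρ τ) x := fun τ hτ i x => by
    rw [← hgrad τ hτ, hmuD']
    simp only [hμ]
    exact (torusSmooth_slice hρs hρper τ).pd_rpow_const (hρpos τ hτ) _ i x
  have hrt : ∀ x, deriv (fun τ => ρ τ x) t
      = -∑ j, pd j (fun y => ρ t y * u t y j) x := fun x => by linarith [hmass t ht x]
  have hRt : TorusSmooth fun y => deriv (fun τ => ρ τ y) t := by
    simpa only [hrt, neg_one_mul] using
      (TorusSmooth.sum fun j => (hr.mul (hu j)).pd j).const_mul (-1)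
  have hvt := fun (i : Fin d) (x : Vec d) =>
    (deriv_mul_drift (c := (s + 3) / 2) hT hρs (hvi i) hρper hρpos i
      (fun τ hτ x => by rw [hdrift τ hτ, hmuD']) ht hRt x).trans
      ((congrArg (fun f => pd i f x) (funext fun y => by rw [← hmuD', hrt])).trans
        (pd_mul_neg_div (k := fun y => muD (ρ t y)) hr hM hL hu hv' (hgrad t ht) (hdrift t ht)
          (fun y => hlam _) i x))
  have hdiv := isTorusDivergence_entropy (ν := ν) (ε := ε) hγ hr hpos hM hL hu hv' (hgrad t ht)
    (hdrift t ht) hrt (ut := fun i x => deriv (fun τ => u τ x i) t)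
    (vt := fun i x => deriv (fun τ => v τ x i) t) (fun i x => by
      rw [← hmom t ht x i]
      congr 4
      exact ((hasDerivAt_time hρs t x).mul
        (hasDerivAt_time (f := fun τ x => u τ x i) (hui i) t x)).deriv.symm) hvt
  have hE : ContDiff ℝ 1 (fun p : ℝ × Vec d =>
      ((ν ^ 2 + ε ^ 2) / 2) * ρ p.1 p.2 * (∑ i, (v p.1 p.2 i) ^ 2)
        + (1 / 2) * ρ p.1 p.2 * (∑ i, (u p.1 p.2 i + ν * v p.1 p.2 i) ^ 2)
        + ρ p.1 p.2 ^ γ / (γ - 1)) := by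
    have hle : (1 : WithTop ℕ∞) ≤ ((⊤ : ℕ∞) : WithTop ℕ∞) := by
      exact_mod_cast (le_top : (1 : ℕ∞) ≤ ⊤)
    have hρ1 := hρs.of_le hle
    have hu1 := fun i => (hui i).of_le hle
    have hv1 := fun i => (hvi i).of_le hle
    have hpow : ContDiff ℝ 1 fun z : ℝ => z ^ γ :=
      Real.contDiff_rpow_const_of_le (n := 1) (by simpa using hγ.le)
    refine (((contDiff_const.mul hρ1).mul (ContDiff.sum fun i _ => (hv1 i).pow 2)).add
      ((contDiff_const.mul hρ1).mul
        (ContDiff.sum fun i _ => ((hu1 i).add (contDiff_const.mul (hv1 i))).pow 2))).add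
      ((hpow.comp hρ1).div_const _)
  have hmain := hasDerivAt_integral_box (E := fun τ x =>
      ((ν ^ 2 + ε ^ 2) / 2) * ρ τ x * (∑ i, (v τ x i) ^ 2)
        + (1 / 2) * ρ τ x * (∑ i, (u τ x i + ν * v τ x i) ^ 2)
        + ρ τ x ^ γ / (γ - 1)) hE t
  refine hmain.hasDerivWithinAt.congr_deriv ?_
  have hderiv : ∀ x, deriv (fun τ =>
      ((ν ^ 2 + ε ^ 2) / 2) * ρ τ x * (∑ i, (v τ x i) ^ 2)
        + (1 / 2) * ρ τ x * (∑ i, (u τ x i + ν * v τ x i) ^ 2)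
        + ρ τ x ^ γ / (γ - 1)) t
      = (ν ^ 2 + ε ^ 2) * ((1 / 2) * deriv (fun τ => ρ τ x) t * (∑ i, v t x i ^ 2)
          + ρ t x * (∑ i, v t x i * deriv (fun τ => v τ x i) t))
        + ((1 / 2) * deriv (fun τ => ρ τ x) t * (∑ i, (u t x i + ν * v t x i) ^ 2)
          + ρ t x * (∑ i, (u t x i + ν * v t x i)
            * (deriv (fun τ => u τ x i) t + ν * deriv (fun τ => v τ x i) t)))
        + γ / (γ - 1) * ρ t x ^ (γ - 1) * deriv (fun τ => ρ τ x) t := fun x => by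
    have dρ := hasDerivAt_time hρs t x
    have du := fun i => hasDerivAt_time (f := fun τ x => u τ x i) (hui i) t x
    have dv := fun i => hasDerivAt_time (f := fun τ x => v τ x i) (hvi i) t x
    have h := (((dρ.const_mul ((ν ^ 2 + ε ^ 2) / 2)).mul
        (HasDerivAt.fun_sum (u := Finset.univ) fun i _ => (dv i).fun_pow 2)).add
      ((dρ.const_mul (1 / 2)).mul (HasDerivAt.fun_sum (u := Finset.univ) fun i _ =>
        ((du i).fun_add ((dv i).const_mul ν)).fun_pow 2))).add
      ((dρ.rpow_const (p := γ) (Or.inr hγ.le)).div_const (γ - 1))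
    refine (HasDerivAt.deriv h).trans ?_
    simp only [Nat.cast_ofNat, Nat.add_one_sub_one, pow_one, mul_assoc,
      ← Finset.mul_sum]
    ring
  rw [integral_congr_ae (Filter.Eventually.of_forall hderiv)]
  symm
  have hprod : Continuous fun x =>
      ν * (μ (ρ t x) * ((∑ i, ∑ j, (pd j (fun y => u t y i) x) ^ 2)
          + ε ^ 2 * (∑ i, ∑ j, (pd j (fun y => v t y i) x) ^ 2))
        + muD (ρ t x) * (γ * ρ t x ^ (γ - 2)) * (∑ i, (pd i (fun y => ρ t y) x) ^ 2)
        + (lam (ρ t x) / 2) * ((∑ i, pd i (fun y => u t y i) x) ^ 2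
            + ε ^ 2 * (∑ i, pd i (fun y => v t y i) x) ^ 2)) := by
    have c1 (i j) : Continuous fun x => pd j (fun y => u t y i) x :=
      ((hu i).pd j).contDiff.continuous
    have c2 (i j) : Continuous fun x => pd j (fun y => v t y i) x :=
      ((hv' i).pd j).contDiff.continuous
    have c3 (i) : Continuous fun x => pd i (fun y => ρ t y) x := (hr.pd i).contDiff.continuous
    have c4 : Continuous fun x => μ (ρ t x) := hM.contDiff.continuous
    have c5 : Continuous fun x => muD (ρ t x) := hk.contDiff.continuous
    have c6 : Continuous fun x => lam (ρ t x) := hL.contDiff.continuous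
    have c7 : Continuous fun x => ρ t x ^ (γ - 2) :=
      (hr.rpow_const hpos (γ - 2)).contDiff.continuous
    exact continuous_const.mul (((c4.mul ((continuous_finsetSum _ fun i _ =>
        continuous_finsetSum _ fun j _ => (c1 i j).pow 2).add (continuous_const.mul
        (continuous_finsetSum _ fun i _ => continuous_finsetSum _ fun j _ =>
          (c2 i j).pow 2)))).add
      ((c5.mul (continuous_const.mul c7)).mul
        (continuous_finsetSum _ fun i _ => (c3 i).pow 2))).add
      ((c6.div_const 2).mul (((continuous_finsetSum _ fun i _ => c1 i i).pow 2).add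
        (continuous_const.mul ((continuous_finsetSum _ fun i _ => c2 i i).pow 2)))))
  have hBox : IsCompact (Box d) := isCompact_Icc
  rw [← integral_const_mul, ← zero_sub, ← hdiv.integral_eq_zero,
    ← integral_sub (hdiv.continuous.continuousOn.integrableOn_compact hBox)
      (hprod.continuousOn.integrableOn_compact hBox)]
  simp only [add_sub_cancel_right]
end
end
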